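/- arXiv:1607.02390 — 3 statements merged into one kernel-verified Lean document; each statement's English description precedes it below -/
import Mathlib

section
/- For every τ > 0 there exists C > 0 such that for every h in (0, (a₁+τ)^(−3/2)] and every real E with E ≤ 0, −a₁ < −h^(−2/3) − E ≤ −c̃₀, and v'(−E)·u(−h^(−2/3)−E) = u'(−E)·v(−h^(−2/3)−E) (i.e. E is the rescaled lower edge E¹_min of the second spectral band at semiclassical parameter h), one has |E + h^(−2/3) − a₁ + √3·α·(u(−a₁))² · exp(−4/(3h) + 2·a₁·h^(−1/3))| ≤ C·h^(1/3)·exp(−4/(3h) + 2·a₁·h^(−1/3)). -/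
open Real Set

/-- The standard Airy function `Ai` expressed in the basis of the canonical
solutions `u`, `v` of the Airy equation. -/
noncomputable def AiF (u v : ℝ → ℝ) (x : ℝ) : ℝ :=
  u x / ((3:ℝ) ^ ((2:ℝ)/3) * Real.Gamma (2/3))
    - v x / ((3:ℝ) ^ ((1:ℝ)/3) * Real.Gamma (1/3))

/-- `α = Γ(1/3)/(3^(1/3)·Γ(2/3)) = −Ai(0)/Ai'(0)`. -/
noncomputable def airyAlpha : ℝ :=
  Real.Gamma (1/3) / ((3:ℝ) ^ ((1:ℝ)/3) * Real.Gamma (2/3))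

open MeasureTheory Filter Topology

/-- The symmetric beta weight `(w (1 - w))^(m - 1)`. -/
noncomputable def symmBetaWeight (m w : ℝ) : ℝ := w ^ (m - 1) * (1 - w) ^ (m - 1)

lemma measurable_symmBetaWeight (m : ℝ) : Measurable (symmBetaWeight m) := by
  unfold symmBetaWeight
  fun_prop

lemma symmBetaWeight_nonneg {m w : ℝ} (hw : w ∈ Ioo (0:ℝ) 1) : 0 ≤ symmBetaWeight m w :=
  mul_nonneg (rpow_nonneg hw.1.le _) (rpow_nonneg (by linarith [hw.2]) _)

lemma integral_symmBetaWeight {m : ℝ} (hm : 0 < m) :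
    ∫ w in Ioo (0:ℝ) 1, symmBetaWeight m w = ProbabilityTheory.beta m m := by
  rw [ProbabilityTheory.beta_eq_betaIntegralReal m m hm hm, Complex.betaIntegral,
    intervalIntegral.integral_of_le (by norm_num), ← integral_Ioc_eq_integral_Ioo,
    ← RCLike.re_to_complex, ← integral_re]
  · refine setIntegral_congr_fun measurableSet_Ioc fun x ⟨hx1, hx2⟩ ↦ ?_
    unfold symmBetaWeight
    norm_cast
    rw [← Complex.ofReal_cpow, ← Complex.ofReal_cpow, RCLike.re_to_complex,
      Complex.re_mul_ofReal, Complex.ofReal_re]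
    all_goals linarith
  · convert! Complex.betaIntegral_convergent (u := m) (v := m) (by simpa) (by simpa)
    rw [intervalIntegrable_iff_integrableOn_Ioc_of_le (by simp), IntegrableOn]

lemma integrable_symmBetaWeight {m : ℝ} (hm : 0 < m) :
    IntegrableOn (symmBetaWeight m) (Ioo 0 1) := by
  by_contra h
  have := integral_symmBetaWeight hm
  rw [integral_undef h] at this
  exact (ProbabilityTheory.beta_pos hm hm).ne this

/-- The moments of `t = 1 - 2 w` in Poisson's integral for the modified Bessel functions. -/
noncomputable def poissonMoment (m : ℝ) (k : ℕ) (z : ℝ) : ℝ :=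
  ∫ w in Ioo (0:ℝ) 1, symmBetaWeight m w * ((1 - 2 * w) ^ k * exp (z * (1 - 2 * w)))

lemma poissonMoment_integrand_le {m w z r : ℝ} (k : ℕ) (hw : w ∈ Ioo (0:ℝ) 1) (hz : |z| ≤ r) :
    ‖symmBetaWeight m w * ((1 - 2 * w) ^ k * exp (z * (1 - 2 * w)))‖
      ≤ symmBetaWeight m w * exp r := by
  have h1 : |1 - 2 * w| ≤ 1 := abs_le.2 ⟨by linarith [hw.2], by linarith [hw.1]⟩
  rw [norm_mul, norm_of_nonneg (symmBetaWeight_nonneg hw), norm_mul, norm_pow,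
    norm_of_nonneg (exp_pos _).le, norm_eq_abs]
  refine mul_le_mul_of_nonneg_left ?_ (symmBetaWeight_nonneg hw)
  calc |1 - 2 * w| ^ k * exp (z * (1 - 2 * w)) ≤ 1 * exp r := by
        refine mul_le_mul (pow_le_one₀ (abs_nonneg _) h1) (exp_le_exp.2 ?_) (exp_pos _).le one_pos.le
        calc z * (1 - 2 * w) ≤ |z * (1 - 2 * w)| := le_abs_self _
          _ = |z| * |1 - 2 * w| := abs_mul _ _
          _ ≤ |z| * 1 := by gcongr
          _ ≤ r := by linarith
    _ = exp r := one_mul _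

lemma integrable_poissonMoment {m : ℝ} (hm : 0 < m) (k : ℕ) (z : ℝ) :
    IntegrableOn (fun w ↦ symmBetaWeight m w * ((1 - 2 * w) ^ k * exp (z * (1 - 2 * w))))
      (Ioo 0 1) := by
  refine Integrable.mono' ((integrable_symmBetaWeight hm).mul_const (exp |z|)) ?_ ?_
  · have := measurable_symmBetaWeight m
    exact Measurable.aestronglyMeasurable (by fun_prop)
  · exact ae_restrict_of_forall_mem measurableSet_Ioo fun w hw ↦
      poissonMoment_integrand_le k hw le_rfl

lemma hasDerivAt_poissonMoment {m : ℝ} (hm : 0 < m) (k : ℕ) (z : ℝ) :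
    HasDerivAt (poissonMoment m k) (poissonMoment m (k + 1) z) z := by
  have hmeas := measurable_symmBetaWeight m
  refine (hasDerivAt_integral_of_dominated_loc_of_deriv_le
    (μ := volume.restrict (Ioo (0:ℝ) 1))
    (F := fun z w ↦ symmBetaWeight m w * ((1 - 2 * w) ^ k * exp (z * (1 - 2 * w))))
    (F' := fun z w ↦ symmBetaWeight m w * ((1 - 2 * w) ^ (k + 1) * exp (z * (1 - 2 * w))))
    (bound := fun w ↦ symmBetaWeight m w * exp (|z| + 1))
    (Metric.ball_mem_nhds z one_pos) ?_ (integrable_poissonMoment hm k z) ?_ ?_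
    ((integrable_symmBetaWeight hm).mul_const _) ?_).2
  · exact Eventually.of_forall fun x ↦ Measurable.aestronglyMeasurable (by fun_prop)
  · exact Measurable.aestronglyMeasurable (by fun_prop)
  · refine ae_restrict_of_forall_mem measurableSet_Ioo fun w hw x hx ↦
      poissonMoment_integrand_le _ hw ?_
    have h1 : |x - z| < 1 := by simpa [Real.dist_eq] using hx
    have h2 : |x| ≤ |x - z| + |z| := by simpa using abs_add_le (x - z) z
    linarith
  · refine ae_restrict_of_forall_mem measurableSet_Ioo fun w _ x _ ↦ ?_
    have h1 : HasDerivAt (fun x ↦ exp (x * (1 - 2 * w)))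
        (exp (x * (1 - 2 * w)) * (1 * (1 - 2 * w))) x :=
      ((hasDerivAt_id x).mul_const _).exp
    refine ((h1.const_mul ((1 - 2 * w) ^ k)).const_mul (symmBetaWeight m w)).congr_deriv ?_
    ring

lemma poissonMoment_zero_zero {m : ℝ} (hm : 0 < m) :
    poissonMoment m 0 0 = ProbabilityTheory.beta m m := by
  simp [poissonMoment, integral_symmBetaWeight hm]

/-- The modified Bessel equation, in Poisson's normalisation. -/
lemma poissonMoment_bessel {m : ℝ} (hm : 0 < m) (z : ℝ) :
    2 * m * poissonMoment m 1 z = z * (poissonMoment m 0 z - poissonMoment m 2 z) := by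
  set g : ℝ → ℝ := fun w ↦ w ^ m * (1 - w) ^ m * exp (z * (1 - 2 * w)) with hg
  set g' : ℝ → ℝ := fun w ↦
    m * (symmBetaWeight m w * ((1 - 2 * w) ^ 1 * exp (z * (1 - 2 * w))))
      - z / 2 * (symmBetaWeight m w * ((1 - 2 * w) ^ 0 * exp (z * (1 - 2 * w)))
        - symmBetaWeight m w * ((1 - 2 * w) ^ 2 * exp (z * (1 - 2 * w)))) with hg'
  have hg_int : IntegrableOn g' (Ioo 0 1) :=
    ((integrable_poissonMoment hm 1 z).const_mul m).sub
      (((integrable_poissonMoment hm 0 z).sub (integrable_poissonMoment hm 2 z)).const_mul (z / 2))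
  have hderiv : ∀ w ∈ Ioo (0:ℝ) 1, HasDerivAt g (g' w) w := by
    intro w hw
    have hw1 : 0 < 1 - w := by linarith [hw.2]
    have e1 : w ^ m = w ^ (m - 1) * w := by
      rw [← rpow_add_one hw.1.ne', sub_add_cancel]
    have e2 : (1 - w) ^ m = (1 - w) ^ (m - 1) * (1 - w) := by
      rw [← rpow_add_one hw1.ne', sub_add_cancel]
    have d1 : HasDerivAt (fun w : ℝ ↦ w ^ m) (m * w ^ (m - 1)) w :=
      hasDerivAt_rpow_const (Or.inl hw.1.ne')
    have d2 : HasDerivAt (fun w : ℝ ↦ (1 - w) ^ m) (-1 * m * (1 - w) ^ (m - 1)) w :=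
      ((hasDerivAt_id w).const_sub 1).rpow_const (Or.inl hw1.ne')
    have d3 : HasDerivAt (fun w ↦ exp (z * (1 - 2 * w)))
        (exp (z * (1 - 2 * w)) * (z * (-(2 * 1)))) w :=
      ((((hasDerivAt_id w).const_mul 2).const_sub 1).const_mul z).exp
    refine ((d1.mul d2).mul d3).congr_deriv ?_
    simp only [hg', symmBetaWeight, e1, e2, Pi.mul_apply]
    ring
  have hcont : ContinuousOn g (Icc 0 1) := by
    have c1 : Continuous fun w : ℝ ↦ w ^ m := continuous_rpow_const hm.le
    have c2 : Continuous fun w : ℝ ↦ (1 - w) ^ m :=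
      (continuous_rpow_const hm.le).comp (continuous_const.sub continuous_id)
    exact ((c1.mul c2).mul (by fun_prop)).continuousOn
  have hFTC := intervalIntegral.integral_eq_sub_of_hasDerivAt_of_le zero_le_one hcont hderiv
    ((intervalIntegrable_iff_integrableOn_Ioo_of_le zero_le_one).2 hg_int)
  rw [intervalIntegral.integral_of_le zero_le_one, integral_Ioc_eq_integral_Ioo] at hFTC
  have hval : ∫ w in Ioo (0:ℝ) 1, g' w
      = m * poissonMoment m 1 z - z / 2 * (poissonMoment m 0 z - poissonMoment m 2 z) := by
    simp only [hg', poissonMoment]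
    rw [integral_sub, integral_const_mul, integral_const_mul, integral_sub]
    · exact integrable_poissonMoment hm 0 z
    · exact integrable_poissonMoment hm 2 z
    · exact (integrable_poissonMoment hm 1 z).const_mul m
    · exact ((integrable_poissonMoment hm 0 z).sub
        (integrable_poissonMoment hm 2 z)).const_mul (z / 2)
  have : g 1 - g 0 = 0 := by simp [hg, zero_rpow hm.ne']
  linarith

lemma rpow_add_one_le_two_mul_exp {m t : ℝ} (hm0 : 0 < m) (hm1 : m ≤ 1) (ht : 0 < t) :
    t ^ (m + 1) ≤ 2 * exp t := by
  rcases le_total t 1 with h | h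
  · have h1 : t ^ (m + 1) ≤ 1 := rpow_le_one ht.le h (by linarith)
    have h2 : 1 ≤ exp t := one_le_exp ht.le
    linarith
  · have h1 : t ^ (m + 1) ≤ t ^ (2:ℝ) := rpow_le_rpow_of_exponent_le h (by linarith)
    have h2 := quadratic_le_exp_of_nonneg ht.le
    rw [rpow_two] at h1
    linarith

lemma watson_remainder_le {m w r : ℝ} (hm0 : 0 < m) (hm1 : m ≤ 1) (hw : w ∈ Ioo (0:ℝ) 1)
    (hr : 0 < r) :
    w ^ m * (1 - w) ^ (m - 1) * exp (-(r * w))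
      ≤ 2 * (w ^ (m + 1 - 1) * exp (-(r * w))) + 4 * (1 / r) ^ (m + 1) * symmBetaWeight m w := by
  have hw1 : 0 < 1 - w := by linarith [hw.2]
  have hsb := symmBetaWeight_nonneg (m := m) hw
  have hrp : 0 ≤ (1 / r) ^ (m + 1) := rpow_nonneg (by positivity) _
  have hwm : 0 ≤ w ^ m := rpow_nonneg hw.1.le _
  have h1wm : 0 ≤ (1 - w) ^ (m - 1) := rpow_nonneg hw1.le _
  rw [add_sub_cancel_right]
  rcases le_total w (1 / 2) with h | h
  · have h1 : (1 - w) ^ (m - 1) ≤ 2 := by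
      calc (1 - w) ^ (m - 1) ≤ (1 - w) ^ (-1 : ℝ) :=
            rpow_le_rpow_of_exponent_ge hw1 (by linarith [hw.1]) (by linarith)
        _ = (1 - w)⁻¹ := rpow_neg_one _
        _ ≤ 2 := by
            rw [inv_le_comm₀ hw1 two_pos]
            linarith
    have h2 : w ^ m * exp (-(r * w)) * (1 - w) ^ (m - 1) ≤ w ^ m * exp (-(r * w)) * 2 :=
      mul_le_mul_of_nonneg_left h1 (by positivity)
    have h3 : 0 ≤ 4 * (1 / r) ^ (m + 1) * symmBetaWeight m w := by positivity
    linarith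
  · have hrw : 0 < r * w := mul_pos hr hw.1
    have h1 : w ^ (m + 1) * exp (-(r * w)) ≤ 2 * (1 / r) ^ (m + 1) := by
      have e : w ^ (m + 1) = (1 / r) ^ (m + 1) * (r * w) ^ (m + 1) := by
        rw [← mul_rpow (by positivity) hrw.le]
        congr 1
        field_simp
      rw [e, mul_assoc, mul_comm 2]
      refine mul_le_mul_of_nonneg_left ?_ hrp
      rw [exp_neg, ← div_eq_mul_inv, div_le_iff₀ (exp_pos _)]
      exact rpow_add_one_le_two_mul_exp hm0 hm1 hrw
    have h2 : w ^ m ≤ 2 * w ^ (m + 1) := by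
      rw [rpow_add_one hw.1.ne']
      nlinarith
    have h3 : w ^ m * exp (-(r * w)) ≤ 4 * (1 / r) ^ (m + 1) := by
      have := mul_le_mul_of_nonneg_right h2 (exp_pos (-(r * w))).le
      linarith
    have h4 : (1 - w) ^ (m - 1) ≤ symmBetaWeight m w := by
      have : 1 ≤ w ^ (m - 1) := one_le_rpow_of_pos_of_le_one_of_nonpos hw.1 hw.2.le (by linarith)
      exact le_mul_of_one_le_left h1wm this
    have h5 : w ^ m * exp (-(r * w)) * (1 - w) ^ (m - 1)
        ≤ 4 * (1 / r) ^ (m + 1) * symmBetaWeight m w :=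
      mul_le_mul h3 h4 h1wm (by positivity)
    have h6 : 0 ≤ w ^ m * exp (-(r * w)) := by positivity
    linarith

lemma integrableOn_rpow_mul_exp_neg_mul_Ioi {a r : ℝ} (ha : 0 < a) (hr : 0 < r) :
    IntegrableOn (fun t : ℝ ↦ t ^ (a - 1) * exp (-(r * t))) (Ioi 0) := by
  by_contra h
  have := integral_rpow_mul_exp_neg_mul_Ioi ha hr
  rw [integral_undef h] at this
  have h2 := Gamma_pos_of_pos ha
  have : 0 < (1 / r) ^ a * Gamma a := by positivity
  linarith

/-- First-order Watson lemma on `(0, 1)`, allowing a beta-type singularity at `1`. -/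
lemma watson_first_order {m C : ℝ} (hm0 : 0 < m) (hm1 : m ≤ 1) (hC : 0 ≤ C) {k : ℝ → ℝ}
    (hkm : Measurable k)
    (hk : ∀ w ∈ Ioo (0:ℝ) 1, |k w - 1| ≤ C * (w * (1 - w) ^ (m - 1))) {r : ℝ} (hr : 0 < r) :
    |r ^ m * (∫ w in Ioo (0:ℝ) 1, w ^ (m - 1) * k w * exp (-(r * w))) - Gamma m|
      ≤ ((2 * C + 1) * Gamma (m + 1) + 4 * C * ProbabilityTheory.beta m m) / r := by
  set e : ℝ → ℝ := fun w ↦ w ^ (m - 1) * exp (-(r * w)) with he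
  set e1 : ℝ → ℝ := fun w ↦ w ^ (m + 1 - 1) * exp (-(r * w)) with he1
  set f : ℝ → ℝ := fun w ↦ w ^ (m - 1) * (k w - 1) * exp (-(r * w)) with hf
  set b : ℝ → ℝ := fun w ↦
    C * (2 * e1 w + 4 * (1 / r) ^ (m + 1) * symmBetaWeight m w) with hb
  have he_int : IntegrableOn e (Ioi 0) := integrableOn_rpow_mul_exp_neg_mul_Ioi hm0 hr
  have he1_int : IntegrableOn e1 (Ioi 0) :=
    integrableOn_rpow_mul_exp_neg_mul_Ioi (by linarith) hr
  have hsub : Ioo (0:ℝ) 1 ⊆ Ioi 0 := Ioo_subset_Ioi_self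
  have hb_int : IntegrableOn b (Ioo 0 1) :=
    (((he1_int.mono_set hsub).const_mul 2).add
      ((integrable_symmBetaWeight hm0).const_mul _)).const_mul C
  have hfb : ∀ w ∈ Ioo (0:ℝ) 1, ‖f w‖ ≤ b w := by
    intro w hw
    have hw0 : 0 ≤ w ^ (m - 1) := rpow_nonneg hw.1.le _
    rw [hf, hb, norm_mul, norm_mul, norm_of_nonneg hw0, norm_of_nonneg (exp_pos _).le, norm_eq_abs]
    calc w ^ (m - 1) * |k w - 1| * exp (-(r * w))
        ≤ w ^ (m - 1) * (C * (w * (1 - w) ^ (m - 1))) * exp (-(r * w)) := by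
          gcongr
          exact hk w hw
      _ = C * (w ^ m * (1 - w) ^ (m - 1) * exp (-(r * w))) := by
          have : w ^ m = w ^ (m - 1) * w := by rw [← rpow_add_one hw.1.ne', sub_add_cancel]
          rw [this]
          ring
      _ ≤ _ := mul_le_mul_of_nonneg_left (watson_remainder_le hm0 hm1 hw hr) hC
  have hf_int : IntegrableOn f (Ioo 0 1) :=
    Integrable.mono' hb_int (Measurable.aestronglyMeasurable (by fun_prop))
      (ae_restrict_of_forall_mem measurableSet_Ioo hfb)
  have hsplit : ∫ w in Ioo (0:ℝ) 1, w ^ (m - 1) * k w * exp (-(r * w))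
      = (∫ w in Ioo (0:ℝ) 1, e w) + ∫ w in Ioo (0:ℝ) 1, f w := by
    rw [← integral_add (he_int.mono_set hsub) hf_int]
    refine setIntegral_congr_fun measurableSet_Ioo fun w _ ↦ ?_
    simp only [he, hf]
    ring
  have htail : ∫ w in Ioi (0:ℝ), e w = (∫ w in Ioo (0:ℝ) 1, e w) + ∫ w in Ioi (1:ℝ), e w := by
    rw [← integral_Ioc_eq_integral_Ioo, ← setIntegral_union (by simp) measurableSet_Ioi
      (he_int.mono_set Ioc_subset_Ioi_self) (he_int.mono_set (Ioi_subset_Ioi zero_le_one)),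
      Ioc_union_Ioi_eq_Ioi zero_le_one]
  have hG : ∫ w in Ioi (0:ℝ), e w = (1 / r) ^ m * Gamma m := integral_rpow_mul_exp_neg_mul_Ioi hm0 hr
  have hG1 : ∫ w in Ioi (0:ℝ), e1 w = (1 / r) ^ (m + 1) * Gamma (m + 1) :=
    integral_rpow_mul_exp_neg_mul_Ioi (by linarith) hr
  have he1_nonneg : ∀ w ∈ Ioi (0:ℝ), 0 ≤ e1 w := fun w hw ↦
    mul_nonneg (rpow_nonneg (le_of_lt hw) _) (exp_pos _).le
  have htail_le : ∫ w in Ioi (1:ℝ), e w ≤ (1 / r) ^ (m + 1) * Gamma (m + 1) := by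
    rw [← hG1]
    calc ∫ w in Ioi (1:ℝ), e w ≤ ∫ w in Ioi (1:ℝ), e1 w := by
          refine setIntegral_mono_on (he_int.mono_set (Ioi_subset_Ioi zero_le_one))
            (he1_int.mono_set (Ioi_subset_Ioi zero_le_one)) measurableSet_Ioi fun w hw ↦ ?_
          exact mul_le_mul_of_nonneg_right
            (rpow_le_rpow_of_exponent_le (le_of_lt hw) (by linarith)) (exp_pos _).le
      _ ≤ _ := setIntegral_mono_set he1_int
          (ae_restrict_of_forall_mem measurableSet_Ioi he1_nonneg)
          (Ioi_subset_Ioi zero_le_one).eventuallyLE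
  have htail_nonneg : 0 ≤ ∫ w in Ioi (1:ℝ), e w :=
    setIntegral_nonneg measurableSet_Ioi fun w hw ↦
      mul_nonneg (rpow_nonneg (zero_le_one.trans (le_of_lt hw)) _) (exp_pos _).le
  have hf_le : |∫ w in Ioo (0:ℝ) 1, f w| ≤ (1 / r) ^ (m + 1)
      * (2 * C * Gamma (m + 1) + 4 * C * ProbabilityTheory.beta m m) := by
    have h1 : ∫ w in Ioo (0:ℝ) 1, b w = C * (2 * (∫ w in Ioo (0:ℝ) 1, e1 w)
        + 4 * (1 / r) ^ (m + 1) * ProbabilityTheory.beta m m) := by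
      rw [hb, integral_const_mul, integral_add ((he1_int.mono_set hsub).const_mul 2)
        ((integrable_symmBetaWeight hm0).const_mul _), integral_const_mul, integral_const_mul,
        integral_symmBetaWeight hm0]
    have h2 : ∫ w in Ioo (0:ℝ) 1, e1 w ≤ (1 / r) ^ (m + 1) * Gamma (m + 1) := by
      rw [← hG1]
      exact setIntegral_mono_set he1_int
        (ae_restrict_of_forall_mem measurableSet_Ioi he1_nonneg) hsub.eventuallyLE
    have h3 : |∫ w in Ioo (0:ℝ) 1, f w| ≤ ∫ w in Ioo (0:ℝ) 1, b w :=
      norm_integral_le_of_norm_le hb_int (ae_restrict_of_forall_mem measurableSet_Ioo hfb)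
    have h4 := mul_le_mul_of_nonneg_left h2 hC
    rw [h1] at h3
    linarith
  have hrm : r ^ m * (1 / r) ^ m = 1 := by
    rw [← mul_rpow hr.le (by positivity), mul_one_div_cancel hr.ne', one_rpow]
  have hrm1 : r ^ m * (1 / r) ^ (m + 1) = 1 / r := by
    rw [rpow_add_one (by positivity), ← mul_assoc, hrm, one_mul]
  have hrpos : 0 < r ^ m := rpow_pos_of_pos hr m
  have hkey : r ^ m * (∫ w in Ioo (0:ℝ) 1, w ^ (m - 1) * k w * exp (-(r * w))) - Gamma m
      = r ^ m * ((∫ w in Ioo (0:ℝ) 1, f w) - ∫ w in Ioi (1:ℝ), e w) := by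
    have : Gamma m = r ^ m * ((∫ w in Ioo (0:ℝ) 1, e w) + ∫ w in Ioi (1:ℝ), e w) := by
      rw [← htail, hG, ← mul_assoc, hrm, one_mul]
    rw [hsplit, this]
    ring
  rw [hkey, abs_mul, abs_of_pos hrpos]
  calc r ^ m * |(∫ w in Ioo (0:ℝ) 1, f w) - ∫ w in Ioi (1:ℝ), e w|
      ≤ r ^ m * ((1 / r) ^ (m + 1)
        * ((2 * C + 1) * Gamma (m + 1) + 4 * C * ProbabilityTheory.beta m m)) := by
        refine mul_le_mul_of_nonneg_left ?_ hrpos.le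
        have := abs_sub (∫ w in Ioo (0:ℝ) 1, f w) (∫ w in Ioi (1:ℝ), e w)
        rw [abs_of_nonneg htail_nonneg] at this
        linarith
    _ = _ := by
        rw [← mul_assoc, hrm1]
        ring

lemma poissonMoment_eq_laplace (m : ℝ) (k : ℕ) (z : ℝ) :
    poissonMoment m k z = exp z * ∫ w in Ioo (0:ℝ) 1,
      w ^ (m - 1) * ((1 - 2 * w) ^ k * (1 - w) ^ (m - 1)) * exp (-(2 * z * w)) := by
  rw [poissonMoment, ← integral_const_mul]
  refine setIntegral_congr_fun measurableSet_Ioo fun w _ ↦ ?_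
  have : exp (z * (1 - 2 * w)) = exp z * exp (-(2 * z * w)) := by
    rw [← exp_add]
    congr 1
    ring
  simp only [symmBetaWeight, this]
  ring

/-- Leading asymptotics of Poisson's integral and of its derivative, with a relative error
of order `1 / z`. -/
lemma poissonMoment_asymptotics {m : ℝ} (hm0 : 0 < m) (hm1 : m ≤ 1) {k : ℕ} (hk : k ≤ 1) :
    ∃ M, 0 ≤ M ∧ ∀ z, 0 < z →
      |(2 * z) ^ m * exp (-z) * poissonMoment m k z - Gamma m| ≤ M / z := by
  have hG := Gamma_pos_of_pos hm0
  have hG1 : 0 < Gamma (m + 1) := Gamma_pos_of_pos (by linarith)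
  have hB := ProbabilityTheory.beta_pos hm0 hm0
  refine ⟨((2 * 3 + 1) * Gamma (m + 1) + 4 * 3 * ProbabilityTheory.beta m m) / 2,
    by positivity, fun z hz ↦ ?_⟩
  have hw := watson_first_order hm0 hm1 (C := 3) (by norm_num)
    (k := fun w ↦ (1 - 2 * w) ^ k * (1 - w) ^ (m - 1)) (by fun_prop) ?_
    (r := 2 * z) (by positivity)
  · rw [poissonMoment_eq_laplace, mul_assoc, ← mul_assoc (exp (-z)), ← exp_add, neg_add_cancel,
      exp_zero, one_mul, div_div]
    exact hw
  · intro w hw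
    have hw1 : 0 < 1 - w := by linarith [hw.2]
    set q := (1 - w) ^ (m - 1) with hq
    have hq1 : 1 ≤ q :=
      one_le_rpow_of_pos_of_le_one_of_nonpos hw1 (by linarith [hw.1]) (by linarith)
    have hq2 : q * (1 - w) ≤ 1 := by
      rw [hq, ← rpow_add_one hw1.ne', sub_add_cancel]
      exact rpow_le_one hw1.le (by linarith [hw.1]) hm0.le
    have hqw : 0 ≤ w * q := mul_nonneg hw.1.le (by linarith)
    interval_cases k
    · rw [abs_le]
      constructor <;> nlinarith
    · rw [abs_le]
      constructor <;> nlinarith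

/-- The phase `ζ = (2/3) x^(3/2)` of the Airy functions. -/
noncomputable def airyZeta (x : ℝ) : ℝ := 2 / 3 * (x * √x)

lemma hasDerivAt_airyZeta {x : ℝ} (hx : 0 < x) : HasDerivAt airyZeta (√x) x := by
  have hs : 0 < √x := sqrt_pos.2 hx
  have hd : HasDerivAt (fun y : ℝ ↦ √y) (1 / (2 * √x)) x := hasDerivAt_sqrt hx.ne'
  refine (((hasDerivAt_id x).mul hd).const_mul (2 / 3)).congr_deriv ?_
  have : x = √x * √x := (mul_self_sqrt hx.le).symm
  simp only [id]
  field_simp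
  nlinarith

lemma continuous_airyZeta : Continuous airyZeta := by
  unfold airyZeta
  fun_prop

lemma hasDerivAt_poissonMoment_airyZeta {m : ℝ} (hm : 0 < m) (k : ℕ) {x : ℝ} (hx : 0 < x) :
    HasDerivAt (fun y ↦ poissonMoment m k (airyZeta y))
      (poissonMoment m (k + 1) (airyZeta x) * √x) x :=
  (hasDerivAt_poissonMoment hm k _).comp x (hasDerivAt_airyZeta hx)

lemma continuous_poissonMoment_airyZeta {m : ℝ} (hm : 0 < m) (k : ℕ) :
    Continuous fun y ↦ poissonMoment m k (airyZeta y) :=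
  (continuous_iff_continuousAt.2 fun z ↦ (hasDerivAt_poissonMoment hm k z).continuousAt).comp
    continuous_airyZeta

/-- Constancy of the Wronskian of two solutions of the Airy equation on `[0, ∞)`. -/
lemma airy_wronskian_eq {f f' g g' : ℝ → ℝ} (hf : Continuous f) (hf' : Continuous f')
    (hfd : ∀ x, 0 < x → HasDerivAt f (f' x) x) (hf'd : ∀ x, 0 < x → HasDerivAt f' (x * f x) x)
    (hg : ∀ x, HasDerivAt g (g' x) x) (hg' : ∀ x, HasDerivAt g' (x * g x) x) {x : ℝ}
    (hx : 0 < x) : f x * g' x - f' x * g x = f 0 * g' 0 - f' 0 * g 0 := by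
  have hgc : Continuous g := continuous_iff_continuousAt.2 fun z ↦ (hg z).continuousAt
  have hgc' : Continuous g' := continuous_iff_continuousAt.2 fun z ↦ (hg' z).continuousAt
  obtain ⟨c, -, hc⟩ := exists_hasDerivAt_eq_slope (fun y ↦ f y * g' y - f' y * g y) (fun _ ↦ 0) hx
    ((hf.mul hgc').sub (hf'.mul hgc)).continuousOn fun y hy ↦
      (((hfd y hy.1).mul (hg' y)).sub ((hf'd y hy.1).mul (hg y))).congr_deriv (by ring)
  have := (div_eq_zero_iff.1 hc.symm).resolve_right (by simpa using hx.ne')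
  linarith

section Canonical

variable {u v u' v' : ℝ → ℝ}

lemma canonical_wronskian
    (hu : ∀ x, HasDerivAt u (u' x) x) (huAiry : ∀ x, HasDerivAt u' (x * u x) x)
    (hv : ∀ x, HasDerivAt v (v' x) x) (hvAiry : ∀ x, HasDerivAt v' (x * v x) x)
    (hu0 : u 0 = 1) (hu'0 : u' 0 = 0) (hv0 : v 0 = 0) (hv'0 : v' 0 = 1) (x : ℝ) :
    u x * v' x - u' x * v x = 1 := by
  have hd : ∀ y, HasDerivAt (fun y ↦ u y * v' y - u' y * v y) 0 y := fun y ↦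
    (((hu y).mul (hvAiry y)).sub ((huAiry y).mul (hv y))).congr_deriv (by ring)
  have := is_const_of_deriv_eq_zero (fun y ↦ (hd y).differentiableAt) (fun y ↦ (hd y).deriv) x 0
  simpa [hu0, hu'0, hv0, hv'0] using this

/-- Poisson's integral for the derivative of the first canonical Airy solution. -/
lemma canonical_u'_eq
    (hu : ∀ x, HasDerivAt u (u' x) x) (huAiry : ∀ x, HasDerivAt u' (x * u x) x)
    (hv : ∀ x, HasDerivAt v (v' x) x) (hvAiry : ∀ x, HasDerivAt v' (x * v x) x)
    (hu0 : u 0 = 1) (hu'0 : u' 0 = 0) (hv0 : v 0 = 0) (hv'0 : v' 0 = 1) {x : ℝ} (hx : 0 < x) :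
    ProbabilityTheory.beta (1 / 6) (1 / 6) * u' x = √x * poissonMoment (1 / 6) 1 (airyZeta x) := by
  have hm : (0:ℝ) < 1 / 6 := by norm_num
  set f : ℝ → ℝ := fun y ↦ poissonMoment (1 / 6) 0 (airyZeta y) with hf
  set f' : ℝ → ℝ := fun y ↦ √y * poissonMoment (1 / 6) 1 (airyZeta y) with hf'
  have hfc : Continuous f := continuous_poissonMoment_airyZeta hm 0
  have hf'c : Continuous f' := continuous_sqrt.mul (continuous_poissonMoment_airyZeta hm 1)
  have hfd : ∀ y, 0 < y → HasDerivAt f (f' y) y := fun y hy ↦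
    (hasDerivAt_poissonMoment_airyZeta hm 0 hy).congr_deriv (mul_comm _ _)
  have hf'd : ∀ y, 0 < y → HasDerivAt f' (y * f y) y := by
    intro y hy
    have hs : 0 < √y := sqrt_pos.2 hy
    refine ((hasDerivAt_sqrt hy.ne').mul
      (hasDerivAt_poissonMoment_airyZeta hm 1 hy)).congr_deriv ?_
    have hB := poissonMoment_bessel hm (airyZeta y)
    have hy2 : √y ^ 2 = y := sq_sqrt hy.le
    simp only [hf]
    rw [airyZeta] at *
    generalize poissonMoment (1 / 6) 0 (2 / 3 * (y * √y)) = p0 at *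
    generalize poissonMoment (1 / 6) 1 (2 / 3 * (y * √y)) = p1 at *
    generalize poissonMoment (1 / 6) (1 + 1) (2 / 3 * (y * √y)) = p2 at *
    generalize √y = s at *
    subst hy2
    field_simp
    nlinarith
  have h1 := airy_wronskian_eq hfc hf'c hfd hf'd hu huAiry hx
  have h2 := airy_wronskian_eq hfc hf'c hfd hf'd hv hvAiry hx
  have h3 := canonical_wronskian hu huAiry hv hvAiry hu0 hu'0 hv0 hv'0 x
  have hf0 : f 0 = ProbabilityTheory.beta (1 / 6) (1 / 6) := by
    simp only [hf, airyZeta, zero_mul, mul_zero, poissonMoment_zero_zero hm]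
  have hf'0 : f' 0 = 0 := by simp [hf']
  rw [hu0, hu'0, hf'0] at h1
  rw [hv0, hv'0, hf0, hf'0] at h2
  linear_combination (-u' x) * h2 + v' x * h1 + f' x * h3

/-- Poisson's integral for the derivative of the second canonical Airy solution. -/
lemma canonical_v'_eq
    (hu : ∀ x, HasDerivAt u (u' x) x) (huAiry : ∀ x, HasDerivAt u' (x * u x) x)
    (hv : ∀ x, HasDerivAt v (v' x) x) (hvAiry : ∀ x, HasDerivAt v' (x * v x) x)
    (hu0 : u 0 = 1) (hu'0 : u' 0 = 0) (hv0 : v 0 = 0) (hv'0 : v' 0 = 1) {x : ℝ} (hx : 0 < x) :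
    ProbabilityTheory.beta (5 / 6) (5 / 6) * v' x
      = poissonMoment (5 / 6) 0 (airyZeta x)
        + x * √x * poissonMoment (5 / 6) 1 (airyZeta x) := by
  have hm : (0:ℝ) < 5 / 6 := by norm_num
  set f : ℝ → ℝ := fun y ↦ y * poissonMoment (5 / 6) 0 (airyZeta y) with hf
  set f' : ℝ → ℝ := fun y ↦ poissonMoment (5 / 6) 0 (airyZeta y)
    + y * √y * poissonMoment (5 / 6) 1 (airyZeta y) with hf'
  have hfc : Continuous f := continuous_id.mul (continuous_poissonMoment_airyZeta hm 0)
  have hf'c : Continuous f' := (continuous_poissonMoment_airyZeta hm 0).add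
    ((continuous_id.mul continuous_sqrt).mul (continuous_poissonMoment_airyZeta hm 1))
  have hfd : ∀ y, 0 < y → HasDerivAt f (f' y) y := fun y hy ↦
    ((hasDerivAt_id y).mul (hasDerivAt_poissonMoment_airyZeta hm 0 hy)).congr_deriv (by
      simp only [hf', id]
      ring)
  have hf'd : ∀ y, 0 < y → HasDerivAt f' (y * f y) y := by
    intro y hy
    have hs : 0 < √y := sqrt_pos.2 hy
    refine ((hasDerivAt_poissonMoment_airyZeta hm 0 hy).add
      (((hasDerivAt_id y).mul (hasDerivAt_sqrt hy.ne')).mul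
        (hasDerivAt_poissonMoment_airyZeta hm 1 hy))).congr_deriv ?_
    have hB := poissonMoment_bessel hm (airyZeta y)
    have hy2 : √y ^ 2 = y := sq_sqrt hy.le
    simp only [hf, id, Pi.mul_apply]
    rw [airyZeta] at *
    norm_num only at *
    generalize poissonMoment (5 / 6) 0 (2 / 3 * (y * √y)) = p0 at *
    generalize poissonMoment (5 / 6) 1 (2 / 3 * (y * √y)) = p1 at *
    generalize poissonMoment (5 / 6) 2 (2 / 3 * (y * √y)) = p2 at *
    generalize √y = s at *
    subst hy2
    field_simp
    linear_combination 3 * hB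
  have h1 := airy_wronskian_eq hfc hf'c hfd hf'd hu huAiry hx
  have h2 := airy_wronskian_eq hfc hf'c hfd hf'd hv hvAiry hx
  have h3 := canonical_wronskian hu huAiry hv hvAiry hu0 hu'0 hv0 hv'0 x
  have hf0 : f 0 = 0 := by simp [hf]
  have hf'0 : f' 0 = ProbabilityTheory.beta (5 / 6) (5 / 6) := by
    simp only [hf', airyZeta, zero_mul, mul_zero, add_zero, poissonMoment_zero_zero hm]
  rw [hu0, hu'0, hf0, hf'0] at h1
  rw [hv0, hv'0, hf0] at h2
  linear_combination (-u' x) * h2 + v' x * h1 + f' x * h3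

end Canonical

/-- The constant in the exponential growth of the derivative of the canonical Airy solution
represented by Poisson's integral of index `m`. -/
noncomputable def airyGrowthConst (m : ℝ) : ℝ :=
  Gamma m / ((4 / 3) ^ m * ProbabilityTheory.beta m m)

lemma airyGrowthConst_pos {m : ℝ} (hm : 0 < m) : 0 < airyGrowthConst m := by
  have h1 := Gamma_pos_of_pos hm
  have h2 := ProbabilityTheory.beta_pos hm hm
  unfold airyGrowthConst
  positivity

lemma airyGrowthConst_eq {m : ℝ} (hm : 0 < m) :
    airyGrowthConst m = Gamma (2 * m) / ((4 / 3) ^ m * Gamma m) := by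
  have h1 := Gamma_pos_of_pos hm
  have h2 : 0 < Gamma (2 * m) := Gamma_pos_of_pos (by linarith)
  rw [airyGrowthConst, ProbabilityTheory.beta, ← two_mul]
  field_simp

lemma rpow_eq_pow_of_mul_eq {a p q : ℝ} (n : ℕ) (ha : 0 ≤ a) (h : p = q * n) :
    a ^ p = (a ^ q) ^ n := by
  rw [h, rpow_mul_natCast ha]

lemma airyGrowthConst_one_sixth :
    airyGrowthConst (1 / 6) = (3:ℝ) ^ ((1:ℝ) / 6) * Gamma (2 / 3) / (2 * √π) := by
  rw [airyGrowthConst_eq (by norm_num)]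
  have hdup := Gamma_mul_Gamma_add_half (1 / 6)
  have h1 : (4 / 3 : ℝ) ^ ((1:ℝ) / 6) = 2 ^ ((1:ℝ) / 3) / 3 ^ ((1:ℝ) / 6) := by
    rw [div_rpow (by norm_num) (by norm_num), show (4:ℝ) = 2 ^ (2:ℝ) by norm_num,
      ← rpow_mul (by norm_num)]
    norm_num
  have h2 : (2:ℝ) ^ (1 - 2 * (1 / 6) : ℝ) = (2 ^ ((1:ℝ) / 3)) ^ 2 :=
    rpow_eq_pow_of_mul_eq 2 (by norm_num) (by norm_num)
  have h3 : ((2:ℝ) ^ ((1:ℝ) / 3)) ^ 3 = 2 := by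
    rw [← rpow_eq_pow_of_mul_eq 3 (by norm_num) (show (1:ℝ) = 1 / 3 * (3:ℕ) by norm_num), rpow_one]
  have h6 : (0:ℝ) < 3 ^ ((1:ℝ) / 6) := by positivity
  rw [h2] at hdup
  rw [h1]
  norm_num only at hdup ⊢
  have g1 : 0 < Gamma (1 / 6) := Gamma_pos_of_pos (by norm_num)
  have hp : 0 < √π := sqrt_pos.2 pi_pos
  have hs : 0 < (2:ℝ) ^ ((1:ℝ) / 3) := by positivity
  generalize (2:ℝ) ^ ((1:ℝ) / 3) = s at *
  generalize (3:ℝ) ^ ((1:ℝ) / 6) = t at *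
  field_simp
  linear_combination (-s) * hdup - Gamma (1 / 3) * √π * h3

lemma airyGrowthConst_five_sixths :
    airyGrowthConst (5 / 6) = Gamma (1 / 3) / (2 * (3:ℝ) ^ ((1:ℝ) / 6) * √π) := by
  rw [airyGrowthConst_eq (by norm_num)]
  have hdup := Gamma_mul_Gamma_add_half (5 / 6)
  have hrec : Gamma (1 / 3 + 1) = 1 / 3 * Gamma (1 / 3) := Gamma_add_one (by norm_num)
  have h1 : (4 / 3 : ℝ) ^ ((5:ℝ) / 6) = (2 ^ ((1:ℝ) / 3)) ^ 5 / (3 ^ ((1:ℝ) / 6)) ^ 5 := by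
    rw [div_rpow (by norm_num) (by norm_num), show (4:ℝ) = 2 ^ (2:ℝ) by norm_num,
      ← rpow_mul (by norm_num), rpow_eq_pow_of_mul_eq (q := 1 / 3) 5 (by norm_num) (by norm_num),
      rpow_eq_pow_of_mul_eq (a := 3) (q := 1 / 6) 5 (by norm_num) (by norm_num)]
  have h2 : (2:ℝ) ^ (1 - 2 * (5 / 6) : ℝ) = ((2 ^ ((1:ℝ) / 3)) ^ 2)⁻¹ := by
    rw [← rpow_eq_pow_of_mul_eq (p := 2 / 3) 2 (by norm_num) (by norm_num),
      ← rpow_neg (by norm_num)]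
    norm_num
  have h3 : ((2:ℝ) ^ ((1:ℝ) / 3)) ^ 3 = 2 := by
    rw [← rpow_eq_pow_of_mul_eq 3 (by norm_num) (show (1:ℝ) = 1 / 3 * (3:ℕ) by norm_num), rpow_one]
  have h4 : ((3:ℝ) ^ ((1:ℝ) / 6)) ^ 6 = 3 := by
    rw [← rpow_eq_pow_of_mul_eq 6 (by norm_num) (show (1:ℝ) = 1 / 6 * (6:ℕ) by norm_num), rpow_one]
  have h6 : (0:ℝ) < 3 ^ ((1:ℝ) / 6) := by positivity
  rw [h2] at hdup
  rw [h1]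
  norm_num only at hdup hrec ⊢
  rw [hrec] at hdup
  have g1 : 0 < Gamma (5 / 6) := Gamma_pos_of_pos (by norm_num)
  have hp : 0 < √π := sqrt_pos.2 pi_pos
  have hs : 0 < (2:ℝ) ^ ((1:ℝ) / 3) := by positivity
  generalize (2:ℝ) ^ ((1:ℝ) / 3) = s at *
  generalize (3:ℝ) ^ ((1:ℝ) / 6) = t at *
  have hG : Gamma (5 / 3) = Gamma (5 / 6) * (1 / 3 * Gamma (1 / 3)) * s ^ 2 / √π := by
    rw [hdup]
    field_simp
  rw [hG]
  field_simp
  rw [h4, h3]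

lemma Gamma_one_third_mul_Gamma_two_thirds :
    Gamma (1 / 3) * Gamma (2 / 3) * √3 = 2 * π := by
  have h := Gamma_mul_Gamma_one_sub (1 / 3)
  rw [show π * (1 / 3) = π / 3 by ring, sin_pi_div_three] at h
  norm_num only at h
  rw [h]
  field_simp

lemma sqrt_three_eq : √3 = ((3:ℝ) ^ ((1:ℝ) / 6)) ^ 3 := by
  rw [sqrt_eq_rpow, rpow_eq_pow_of_mul_eq 3 (by norm_num)]
  norm_num

lemma airyGrowthConst_ratio :
    airyGrowthConst (1 / 6) / airyGrowthConst (5 / 6) = 1 / airyAlpha := by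
  rw [airyGrowthConst_one_sixth, airyGrowthConst_five_sixths, airyAlpha,
    rpow_eq_pow_of_mul_eq (p := 1 / 3) (q := 1 / 6) 2 (by norm_num) (by norm_num)]
  have g1 : 0 < Gamma (1 / 3) := Gamma_pos_of_pos (by norm_num)
  have g2 : 0 < Gamma (2 / 3) := Gamma_pos_of_pos (by norm_num)
  have hp : 0 < √π := sqrt_pos.2 pi_pos
  have h6 : (0:ℝ) < 3 ^ ((1:ℝ) / 6) := by positivity
  field_simp

lemma one_div_two_mul_airyGrowthConst_sq :
    1 / (2 * airyGrowthConst (5 / 6) ^ 2) = √3 / airyAlpha := by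
  have hG := Gamma_one_third_mul_Gamma_two_thirds
  rw [airyGrowthConst_five_sixths, airyAlpha,
    rpow_eq_pow_of_mul_eq (p := 1 / 3) (q := 1 / 6) 2 (by norm_num) (by norm_num)]
  rw [sqrt_three_eq] at *
  have g1 : 0 < Gamma (1 / 3) := Gamma_pos_of_pos (by norm_num)
  have g2 : 0 < Gamma (2 / 3) := Gamma_pos_of_pos (by norm_num)
  have hp : 0 < √π := sqrt_pos.2 pi_pos
  have h6 : (0:ℝ) < 3 ^ ((1:ℝ) / 6) := by positivity
  have hpi : √π ^ 2 = π := sq_sqrt pi_pos.le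
  generalize (3:ℝ) ^ ((1:ℝ) / 6) = t at *
  field_simp
  rw [hpi]
  linear_combination -hG

lemma one_le_mul_sqrt {x : ℝ} (hx : 1 ≤ x) : 1 ≤ x * √x := by
  nlinarith [one_le_sqrt.2 hx]

lemma two_mul_airyZeta_rpow {x m : ℝ} (hx : 0 < x) :
    (2 * airyZeta x) ^ m = (4 / 3) ^ m * x ^ (3 / 2 * m) := by
  have h : 2 * airyZeta x = 4 / 3 * x ^ (3 / 2 : ℝ) := by
    rw [airyZeta, sqrt_eq_rpow, ← rpow_one_add' hx.le (by norm_num)]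
    norm_num
    ring
  rw [h, mul_rpow (by norm_num) (by positivity), ← rpow_mul hx.le]

lemma exp_neg_airyZeta_poissonMoment_asymptotics {m : ℝ} (hm0 : 0 < m) (hm1 : m ≤ 1) {k : ℕ}
    (hk : k ≤ 1) :
    ∃ M, 0 ≤ M ∧ ∀ x, 1 ≤ x →
      |x ^ (3 / 2 * m) * exp (-airyZeta x) * poissonMoment m k (airyZeta x)
          / ProbabilityTheory.beta m m - airyGrowthConst m| ≤ M / (x * √x) := by
  obtain ⟨M, hM, h⟩ := poissonMoment_asymptotics hm0 hm1 hk
  have hB := ProbabilityTheory.beta_pos hm0 hm0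
  have h43 : (0:ℝ) < (4 / 3) ^ m := by positivity
  refine ⟨3 / 2 * M / ((4 / 3) ^ m * ProbabilityTheory.beta m m), by positivity, fun x hx ↦ ?_⟩
  have hx0 : 0 < x := by linarith
  have hxs := one_le_mul_sqrt hx
  have hz : 0 < airyZeta x := by
    rw [airyZeta]
    linarith
  have h1 := h _ hz
  rw [two_mul_airyZeta_rpow hx0] at h1
  have e : x ^ (3 / 2 * m) * exp (-airyZeta x) * poissonMoment m k (airyZeta x)
      / ProbabilityTheory.beta m m - airyGrowthConst m
      = ((4 / 3) ^ m * x ^ (3 / 2 * m) * exp (-airyZeta x) * poissonMoment m k (airyZeta x)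
        - Gamma m) / ((4 / 3) ^ m * ProbabilityTheory.beta m m) := by
    rw [airyGrowthConst]
    field_simp
  rw [e, abs_div, abs_of_pos (by positivity : 0 < (4 / 3) ^ m * ProbabilityTheory.beta m m),
    div_le_iff₀ (by positivity)]
  refine h1.trans (le_of_eq ?_)
  rw [airyZeta]
  field_simp

section Canonical

variable {u v u' v' : ℝ → ℝ}

lemma canonical_u'_asymptotics
    (hu : ∀ x, HasDerivAt u (u' x) x) (huAiry : ∀ x, HasDerivAt u' (x * u x) x)
    (hv : ∀ x, HasDerivAt v (v' x) x) (hvAiry : ∀ x, HasDerivAt v' (x * v x) x)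
    (hu0 : u 0 = 1) (hu'0 : u' 0 = 0) (hv0 : v 0 = 0) (hv'0 : v' 0 = 1) :
    ∃ M, 0 ≤ M ∧ ∀ x, 1 ≤ x →
      |u' x / (x ^ (1 / 4 : ℝ) * exp (airyZeta x)) - airyGrowthConst (1 / 6)| ≤ M / (x * √x) := by
  obtain ⟨M, hM, h⟩ := exp_neg_airyZeta_poissonMoment_asymptotics (m := 1 / 6) (k := 1)
    (by norm_num) (by norm_num) le_rfl
  refine ⟨M, hM, fun x hx ↦ ?_⟩
  have hx0 : 0 < x := by linarith
  have hB : 0 < ProbabilityTheory.beta (1 / 6) (1 / 6) :=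
    ProbabilityTheory.beta_pos (by norm_num) (by norm_num)
  convert h x hx using 3
  have hE := canonical_u'_eq hu huAiry hv hvAiry hu0 hu'0 hv0 hv'0 hx0
  have hp : x ^ (3 / 2 * (1 / 6) : ℝ) = x ^ (1 / 4 : ℝ) := by norm_num
  have hs : √x = x ^ (1 / 4 : ℝ) * x ^ (1 / 4 : ℝ) := by
    rw [← rpow_add hx0, sqrt_eq_rpow]
    norm_num
  have hq : 0 < x ^ (1 / 4 : ℝ) := by positivity
  have hexp := exp_pos (airyZeta x)
  rw [hs] at hE
  rw [hp, exp_neg]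
  field_simp
  linear_combination hE

lemma canonical_v'_asymptotics
    (hu : ∀ x, HasDerivAt u (u' x) x) (huAiry : ∀ x, HasDerivAt u' (x * u x) x)
    (hv : ∀ x, HasDerivAt v (v' x) x) (hvAiry : ∀ x, HasDerivAt v' (x * v x) x)
    (hu0 : u 0 = 1) (hu'0 : u' 0 = 0) (hv0 : v 0 = 0) (hv'0 : v' 0 = 1) :
    ∃ M, 0 ≤ M ∧ ∀ x, 1 ≤ x →
      |v' x / (x ^ (1 / 4 : ℝ) * exp (airyZeta x)) - airyGrowthConst (5 / 6)| ≤ M / (x * √x) := by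
  obtain ⟨M0, hM0, h0⟩ := exp_neg_airyZeta_poissonMoment_asymptotics (m := 5 / 6) (k := 0)
    (by norm_num) (by norm_num) zero_le_one
  obtain ⟨M1, hM1, h1⟩ := exp_neg_airyZeta_poissonMoment_asymptotics (m := 5 / 6) (k := 1)
    (by norm_num) (by norm_num) le_rfl
  have hK : 0 < airyGrowthConst (5 / 6) := airyGrowthConst_pos (by norm_num)
  refine ⟨M1 + (airyGrowthConst (5 / 6) + M0), by positivity, fun x hx ↦ ?_⟩
  have hx0 : 0 < x := by linarith
  have hxs := one_le_mul_sqrt hx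
  have hB : 0 < ProbabilityTheory.beta (5 / 6) (5 / 6) :=
    ProbabilityTheory.beta_pos (by norm_num) (by norm_num)
  have hE := canonical_v'_eq hu huAiry hv hvAiry hu0 hu'0 hv0 hv'0 hx0
  have hp : x ^ (3 / 2 * (5 / 6) : ℝ) * x ^ (1 / 4 : ℝ) = x * √x := by
    rw [← rpow_add hx0, sqrt_eq_rpow, ← rpow_one_add' hx0.le (by norm_num)]
    norm_num
  have hq : 0 < x ^ (1 / 4 : ℝ) := by positivity
  have hexp := exp_pos (airyZeta x)
  have key : v' x / (x ^ (1 / 4 : ℝ) * exp (airyZeta x))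
      = x ^ (3 / 2 * (5 / 6) : ℝ) * exp (-airyZeta x) * poissonMoment (5 / 6) 1 (airyZeta x)
          / ProbabilityTheory.beta (5 / 6) (5 / 6)
        + (x ^ (3 / 2 * (5 / 6) : ℝ) * exp (-airyZeta x) * poissonMoment (5 / 6) 0 (airyZeta x)
          / ProbabilityTheory.beta (5 / 6) (5 / 6)) / (x * √x) := by
    rw [exp_neg, ← hp]
    rw [← hp] at hE
    have hr : 0 < x ^ (3 / 2 * (5 / 6) : ℝ) := by positivity
    generalize x ^ (3 / 2 * (5 / 6) : ℝ) = r at *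
    field_simp
    linear_combination hE
  have h0x := h0 x hx
  have h1x := h1 x hx
  rw [key]
  generalize x ^ (3 / 2 * (5 / 6) : ℝ) * exp (-airyZeta x) * poissonMoment (5 / 6) 0 (airyZeta x)
          / ProbabilityTheory.beta (5 / 6) (5 / 6) = p0 at *
  generalize x ^ (3 / 2 * (5 / 6) : ℝ) * exp (-airyZeta x) * poissonMoment (5 / 6) 1 (airyZeta x)
          / ProbabilityTheory.beta (5 / 6) (5 / 6) = p1 at *
  have hp0 : |p0| ≤ airyGrowthConst (5 / 6) + M0 := by
    have h2 : M0 / (x * √x) ≤ M0 := div_le_self hM0 hxs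
    have h3 := abs_add_le (p0 - airyGrowthConst (5 / 6)) (airyGrowthConst (5 / 6))
    rw [sub_add_cancel, abs_of_pos hK] at h3
    linarith
  calc |p1 + p0 / (x * √x) - airyGrowthConst (5 / 6)|
      = |(p1 - airyGrowthConst (5 / 6)) + p0 / (x * √x)| := by
        congr 1
        ring
    _ ≤ |p1 - airyGrowthConst (5 / 6)| + |p0 / (x * √x)| := abs_add_le _ _
    _ ≤ M1 / (x * √x) + (airyGrowthConst (5 / 6) + M0) / (x * √x) := by
        rw [abs_div, abs_of_pos (by positivity : 0 < x * √x)]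
        gcongr
    _ = _ := by ring

end Canonical

lemma tendsto_mul_sqrt_atTop : Tendsto (fun x : ℝ ↦ x * √x) atTop atTop :=
  tendsto_id.atTop_mul_atTop₀ tendsto_sqrt_atTop

lemma tendsto_of_abs_sub_le_div_mul_sqrt {q : ℝ → ℝ} {K M : ℝ}
    (h : ∀ x, 1 ≤ x → |q x - K| ≤ M / (x * √x)) : Tendsto q atTop (𝓝 K) := by
  rw [tendsto_iff_norm_sub_tendsto_zero]
  refine squeeze_zero' (Eventually.of_forall fun _ ↦ norm_nonneg _)
    ((eventually_ge_atTop 1).mono h) ?_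
  exact tendsto_const_nhds.div_atTop tendsto_mul_sqrt_atTop

lemma hasDerivAt_exp_neg_two_mul_airyZeta {x : ℝ} (hx : 0 < x) :
    HasDerivAt (fun y ↦ exp (-2 * airyZeta y)) (-2 * √x * exp (-2 * airyZeta x)) x :=
  (((hasDerivAt_airyZeta hx).const_mul (-2)).exp).congr_deriv (by ring)

lemma tendsto_exp_neg_two_mul_airyZeta :
    Tendsto (fun y ↦ exp (-2 * airyZeta y)) atTop (𝓝 0) := by
  refine (tendsto_exp_neg_atTop_nhds_zero.comp
    (tendsto_mul_sqrt_atTop.const_mul_atTop (by norm_num : (0:ℝ) < 4 / 3))).congr fun x ↦ ?_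
  simp only [Function.comp, airyZeta]
  congr 1
  ring

/-- A function vanishing at infinity whose derivative is bounded on `[Y, ∞)` by a multiple of
`√x exp (-2ζ)` is bounded by a multiple of `exp (-2ζ)`. -/
lemma abs_le_of_deriv_abs_le_exp_airyZeta {f f' : ℝ → ℝ} {Y ε : ℝ} (hY : 0 < Y)
    (hf : ∀ x, Y ≤ x → HasDerivAt f (f' x) x)
    (hf' : ∀ x, Y ≤ x → |f' x| ≤ 2 * ε * (√x * exp (-2 * airyZeta x)))
    (hlim : Tendsto f atTop (𝓝 0)) : |f Y| ≤ ε * exp (-2 * airyZeta Y) := by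
  have upper : ∀ g g' : ℝ → ℝ, (∀ x, Y ≤ x → HasDerivAt g (g' x) x) →
      (∀ x, Y ≤ x → |g' x| ≤ 2 * ε * (√x * exp (-2 * airyZeta x))) →
      Tendsto g atTop (𝓝 0) → g Y ≤ ε * exp (-2 * airyZeta Y) := by
    intro g g' hg hg' hglim
    have hd : ∀ x, Y ≤ x → HasDerivAt (fun y ↦ g y - ε * exp (-2 * airyZeta y))
        (g' x - ε * (-2 * √x * exp (-2 * airyZeta x))) x := fun x hx ↦
      (hg x hx).sub ((hasDerivAt_exp_neg_two_mul_airyZeta (by linarith)).const_mul ε)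
    have hmono : MonotoneOn (fun y ↦ g y - ε * exp (-2 * airyZeta y)) (Ici Y) := by
      refine monotoneOn_of_hasDerivWithinAt_nonneg (convex_Ici Y)
        (fun x hx ↦ (hd x hx).continuousAt.continuousWithinAt)
        (fun x hx ↦ (hd x (interior_subset hx)).hasDerivWithinAt) fun x hx ↦ ?_
      have := neg_le_of_abs_le (hg' x (interior_subset hx))
      linarith
    have hl : Tendsto (fun y ↦ g y - ε * exp (-2 * airyZeta y)) atTop (𝓝 (0 - ε * 0)) :=
      hglim.sub (tendsto_exp_neg_two_mul_airyZeta.const_mul ε)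
    have := ge_of_tendsto hl ((eventually_ge_atTop Y).mono fun x hx ↦
      hmono (mem_Ici.2 le_rfl) (mem_Ici.2 hx) hx)
    linarith
  refine abs_le.2 ⟨?_, upper f f' hf hf' hlim⟩
  have := upper (fun y ↦ -f y) (fun y ↦ -f' y) (fun x hx ↦ (hf x hx).neg)
    (fun x hx ↦ by simpa using hf' x hx) (by simpa using hlim.neg)
  linarith

section Canonical

variable {u v u' v' : ℝ → ℝ}

/-- Asymptotics of the gap between `u' / v'` and its limit `1 / α` at infinity. -/
lemma canonical_ratio_gap
    (hu : ∀ x, HasDerivAt u (u' x) x) (huAiry : ∀ x, HasDerivAt u' (x * u x) x)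
    (hv : ∀ x, HasDerivAt v (v' x) x) (hvAiry : ∀ x, HasDerivAt v' (x * v x) x)
    (hu0 : u 0 = 1) (hu'0 : u' 0 = 0) (hv0 : v 0 = 0) (hv'0 : v' 0 = 1) :
    ∃ M Y, 0 ≤ M ∧ 1 ≤ Y ∧ ∀ y, Y ≤ y → 0 < v' y ∧
      |1 / airyAlpha - u' y / v' y - √3 / airyAlpha * exp (-2 * airyZeta y)|
        ≤ M / √y * exp (-2 * airyZeta y) := by
  obtain ⟨Mu, -, hMu⟩ := canonical_u'_asymptotics hu huAiry hv hvAiry hu0 hu'0 hv0 hv'0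
  obtain ⟨M, hM, hMv⟩ := canonical_v'_asymptotics hu huAiry hv hvAiry hu0 hu'0 hv0 hv'0
  have hK : 0 < airyGrowthConst (5 / 6) := airyGrowthConst_pos (by norm_num)
  have hlu := tendsto_of_abs_sub_le_div_mul_sqrt hMu
  have hlv := tendsto_of_abs_sub_le_div_mul_sqrt hMv
  rw [← airyGrowthConst_ratio, ← one_div_two_mul_airyGrowthConst_sq]
  set K := airyGrowthConst (5 / 6) with hKdef
  set q : ℝ → ℝ := fun x ↦ v' x / (x ^ (1 / 4 : ℝ) * exp (airyZeta x)) with hq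
  have hev : ∀ᶠ x in atTop, K / 2 < q x ∧ q x < 2 * K :=
    (hlv.eventually (lt_mem_nhds (by linarith))).and (hlv.eventually (gt_mem_nhds (by linarith)))
  obtain ⟨Y, hY⟩ := eventually_atTop.1 (hev.and (eventually_ge_atTop 1))
  have hY1 : 1 ≤ Y := (hY Y le_rfl).2
  have hden : ∀ x, Y ≤ x → 0 < x ^ (1 / 4 : ℝ) * exp (airyZeta x) := fun x hx ↦
    mul_pos (rpow_pos_of_pos (by linarith) _) (exp_pos _)
  have hv'q : ∀ x, Y ≤ x → v' x = q x * (x ^ (1 / 4 : ℝ) * exp (airyZeta x)) := fun x hx ↦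
    (div_mul_cancel₀ _ (hden x hx).ne').symm
  have hv'pos : ∀ x, Y ≤ x → 0 < v' x := fun x hx ↦ by
    rw [hv'q x hx]
    exact mul_pos (by linarith [(hY x hx).1.1]) (hden x hx)
  have hv'sq : ∀ x, Y ≤ x → x / v' x ^ 2 = √x * exp (-2 * airyZeta x) / q x ^ 2 := by
    intro x hx
    have hx0 : 0 < x := by linarith
    have hq0 : 0 < q x := by linarith [(hY x hx).1.1]
    have h1 : (x ^ (1 / 4 : ℝ)) ^ 2 = √x := by
      rw [sqrt_eq_rpow, ← rpow_eq_pow_of_mul_eq (p := 1 / 2) (q := 1 / 4) 2 hx0.le (by norm_num)]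
    have h2 : exp (-2 * airyZeta x) = (exp (airyZeta x) ^ 2)⁻¹ := by
      rw [← exp_nat_mul, ← exp_neg]
      congr 1
      push_cast
      ring
    have h3 : √x * √x = x := mul_self_sqrt hx0.le
    have h4 : 0 < √x := sqrt_pos.2 hx0
    have h5 := exp_pos (airyZeta x)
    rw [hv'q x hx, mul_pow, mul_pow, h1, h2]
    field_simp
    linarith
  refine ⟨6 * M / K ^ 3, Y, by positivity, hY1, fun y hy ↦ ⟨hv'pos y hy, ?_⟩⟩
  have hy1 : 1 ≤ y := by linarith
  set Ku := airyGrowthConst (1 / 6) with hKu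
  refine abs_le_of_deriv_abs_le_exp_airyZeta
    (f := fun x ↦ Ku / K - u' x / v' x - 1 / (2 * K ^ 2) * exp (-2 * airyZeta x))
    (f' := fun x ↦ √x * exp (-2 * airyZeta x) * (1 / K ^ 2 - 1 / q x ^ 2))
    (by linarith) (fun x hx ↦ ?_) (fun x hx ↦ ?_) ?_
  · have hYx : Y ≤ x := hy.trans hx
    have hpos := hv'pos x hYx
    have hsq := hv'sq x hYx
    have hW := canonical_wronskian hu huAiry hv hvAiry hu0 hu'0 hv0 hv'0 x
    refine ((((huAiry x).div (hvAiry x) hpos.ne').const_sub (Ku / K)).sub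
      ((hasDerivAt_exp_neg_two_mul_airyZeta (by linarith)).const_mul
        (1 / (2 * K ^ 2)))).congr_deriv ?_
    have h1 : (x * u x * v' x - u' x * (x * v x)) / v' x ^ 2 = x / v' x ^ 2 := by
      congr 1
      linear_combination x * hW
    rw [h1, hsq]
    field_simp
    ring
  · obtain ⟨⟨hq1, hq2⟩, -⟩ := hY x (hy.trans hx)
    have hx1 : 1 ≤ x := hy1.trans hx
    have hq0 : 0 < q x := by linarith
    have hqM : |q x - K| ≤ M / √y := by
      refine (hMv x hx1).trans ?_
      have h1 : √y ≤ √x := sqrt_le_sqrt hx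
      have h2 : 0 < √y := sqrt_pos.2 (by linarith)
      have h3 : √x ≤ x * √x := le_mul_of_one_le_left (by linarith) hx1
      exact div_le_div_of_nonneg_left hM h2 (h1.trans h3)
    have hA : 0 ≤ √x * exp (-2 * airyZeta x) := by positivity
    have hdiff : |1 / K ^ 2 - 1 / q x ^ 2| ≤ 12 / K ^ 3 * |q x - K| := by
      have e : 1 / K ^ 2 - 1 / q x ^ 2 = (q x + K) / (K ^ 2 * q x ^ 2) * (q x - K) := by
        field_simp
        ring
      rw [e, abs_mul, abs_of_pos (by positivity)]
      refine mul_le_mul_of_nonneg_right ?_ (abs_nonneg _)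
      rw [div_le_div_iff₀ (by positivity) (by positivity)]
      have h1 : K ^ 2 ≤ 4 * q x ^ 2 := by nlinarith
      calc (q x + K) * K ^ 3 ≤ 3 * K * K ^ 3 := by
            gcongr
            linarith
        _ = 3 * K ^ 2 * K ^ 2 := by ring
        _ ≤ 3 * K ^ 2 * (4 * q x ^ 2) := by gcongr
        _ = 12 * (K ^ 2 * q x ^ 2) := by ring
    rw [abs_mul, abs_of_nonneg hA, mul_comm]
    refine mul_le_mul_of_nonneg_right ?_ hA
    calc |1 / K ^ 2 - 1 / q x ^ 2| ≤ 12 / K ^ 3 * |q x - K| := hdiff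
      _ ≤ 12 / K ^ 3 * (M / √y) := by gcongr
      _ = 2 * (6 * M / K ^ 3 / √y) := by ring
  · have hratio : Tendsto (fun x ↦ u' x / v' x) atTop (𝓝 (Ku / K)) := by
      refine (hlu.div hlv hK.ne').congr' ?_
      filter_upwards [eventually_ge_atTop Y] with x hx
      exact div_div_div_cancel_right₀ (hden x hx).ne' _ _
    have hlim := (hratio.const_sub (Ku / K)).sub
      (tendsto_exp_neg_two_mul_airyZeta.const_mul (1 / (2 * K ^ 2)))
    rwa [sub_self, mul_zero, sub_zero] at hlim

lemma airyAlpha_pos : 0 < airyAlpha := by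
  have g1 : 0 < Gamma (1 / 3) := Gamma_pos_of_pos (by norm_num)
  have g2 : 0 < Gamma (2 / 3) := Gamma_pos_of_pos (by norm_num)
  unfold airyAlpha
  positivity

lemma AiF_eq (u v : ℝ → ℝ) (x : ℝ) :
    AiF u v x
      = 1 / ((3:ℝ) ^ ((1:ℝ) / 3) * Gamma (1 / 3)) * (airyAlpha * u x - v x) := by
  have g1 : 0 < Gamma (1 / 3) := Gamma_pos_of_pos (by norm_num)
  have g2 : 0 < Gamma (2 / 3) := Gamma_pos_of_pos (by norm_num)
  have h3 : (0:ℝ) < 3 ^ ((1:ℝ) / 3) := by positivity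
  rw [AiF, airyAlpha, rpow_eq_pow_of_mul_eq (p := 2 / 3) (q := 1 / 3) 2 (by norm_num) (by norm_num)]
  field_simp

lemma canonical_v_neg
    (hu : ∀ x, HasDerivAt u (u' x) x) (huAiry : ∀ x, HasDerivAt u' (x * u x) x)
    (hv : ∀ x, HasDerivAt v (v' x) x) (hvAiry : ∀ x, HasDerivAt v' (x * v x) x)
    (hu0 : u 0 = 1) (hu'0 : u' 0 = 0) (hv0 : v 0 = 0) (hv'0 : v' 0 = 1)
    {a : ℝ} (ha : 0 < a) (haz : airyAlpha * u (-a) = v (-a))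
    (hane : ∀ x, -a < x → airyAlpha * u x - v x ≠ 0) {x : ℝ} (hx : x ∈ Ico (-a) 0) :
    v x < 0 := by
  have hα := airyAlpha_pos
  have hW := canonical_wronskian hu huAiry hv hvAiry hu0 hu'0 hv0 hv'0
  have hvc : Continuous v := continuous_iff_continuousAt.2 fun z ↦ (hv z).continuousAt
  have hneg : ∀ y ∈ Ioo (-a) 0, v y < 0 := by
    intro y hy
    set p : ℝ → ℝ := fun y ↦ airyAlpha * u y - v y with hp
    have hpd : ∀ z, HasDerivAt p (airyAlpha * u' z - v' z) z := fun z ↦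
      ((hu z).const_mul _).sub (hv z)
    have hd : ∀ z ∈ Icc y 0, HasDerivAt (fun z ↦ v z / p z)
        (airyAlpha / p z ^ 2) z := fun z hz ↦ by
      refine ((hv z).div (hpd z) (hane z (by linarith [hy.1, hz.1]))).congr_deriv ?_
      congr 1
      simp only [hp]
      linear_combination airyAlpha * hW z
    obtain ⟨c, hc, hslope⟩ := exists_hasDerivAt_eq_slope (fun z ↦ v z / p z) _ hy.2
      (fun z hz ↦ (hd z hz).continuousAt.continuousWithinAt)
      (fun z hz ↦ hd z (Ioo_subset_Icc_self hz))
    have hpc : p c ≠ 0 := hane c (by linarith [hy.1, hc.1])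
    have hpos : 0 < airyAlpha / p c ^ 2 := by positivity
    rw [hslope, hv0, zero_div, zero_sub, zero_sub] at hpos
    have hquot : v y / p y < 0 := by
      by_contra! h
      exact hpos.not_ge (div_nonpos_of_nonpos_of_nonneg (by linarith) (by linarith [hy.2]))
    have hpy : 0 < p y := by
      by_contra! h
      have hp0 : 0 ≤ p 0 := by simp [hp, hu0, hv0, hα.le]
      obtain ⟨z, hz, hz0⟩ := intermediate_value_Icc hy.2.le
        (fun z _ ↦ (hpd z).continuousAt.continuousWithinAt) (show (0:ℝ) ∈ Icc (p y) (p 0) from ⟨h, hp0⟩)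
      exact hane z (by linarith [hy.1, hz.1]) hz0
    by_contra! h
    exact hquot.not_ge (div_nonneg h hpy.le)
  rcases eq_or_lt_of_le hx.1 with h | h
  · have hle : v (-a) ≤ 0 := by
      refine le_of_tendsto (hvc.continuousWithinAt (s := Ioi (-a)) (x := -a)) ?_
      filter_upwards [Ioo_mem_nhdsGT (show -a < 0 by linarith)] with y hy using (hneg y hy).le
    rw [← h]
    refine lt_of_le_of_ne hle fun h0 ↦ ?_
    have hu1 : u (-a) = 0 := by
      rw [h0] at haz
      exact (mul_eq_zero.1 haz).resolve_left hα.ne'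
    have := hW (-a)
    rw [h0, hu1] at this
    norm_num at this
  · exact hneg x ⟨h, hx.2⟩

/-- Taylor's formula with `s = p² - q²`. -/
lemma cube_sub_cube_bounds {p q s : ℝ} (hp : 0 ≤ p) (hq : 0 < q) (h : p ^ 2 = q ^ 2 + s) :
    0 ≤ p ^ 3 - q ^ 3 - 3 / 2 * s * q ∧ p ^ 3 - q ^ 3 - 3 / 2 * s * q ≤ s ^ 2 / q := by
  have hs : s = (p - q) * (p + q) := by linear_combination -h
  have e : p ^ 3 - q ^ 3 - 3 / 2 * s * q = (p - q) ^ 2 * (p + q / 2) := by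
    rw [hs]
    ring
  rw [e]
  refine ⟨by positivity, ?_⟩
  rw [le_div_iff₀ hq, hs, mul_pow, mul_assoc]
  exact mul_le_mul_of_nonneg_left (by nlinarith [mul_nonneg hp hq.le]) (sq_nonneg _)

lemma exp_neg_four_thirds_cube_le {p : ℝ} (hp : 0 < p) : exp (-(4 / 3 * p ^ 3)) ≤ 1 / p ^ 3 := by
  rw [exp_neg, ← one_div]
  refine one_div_le_one_div_of_le (by positivity) ?_
  have := add_one_le_exp (4 / 3 * p ^ 3)
  have : 0 < p ^ 3 := by positivity
  linarith

set_option maxHeartbeats 400000 in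
/-- The solution `s` of the quantisation condition is exponentially close to the zero `-a` of
the recessive solution; quantitative version in terms of `q = h^(-1/3)`. -/
lemma canonical_edge_asymptotics
    (hu : ∀ x, HasDerivAt u (u' x) x) (huAiry : ∀ x, HasDerivAt u' (x * u x) x)
    (hv : ∀ x, HasDerivAt v (v' x) x) (hvAiry : ∀ x, HasDerivAt v' (x * v x) x)
    (hu0 : u 0 = 1) (hu'0 : u' 0 = 0) (hv0 : v 0 = 0) (hv'0 : v' 0 = 1)
    {a : ℝ} (ha : 0 < a) (haz : airyAlpha * u (-a) = v (-a))
    (hane : ∀ x, -a < x → airyAlpha * u x - v x ≠ 0) :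
    ∃ C, 0 < C ∧ ∀ q s : ℝ, 0 < q → -a < s → s < 0 →
      v' (q ^ 2 + s) * u s = u' (q ^ 2 + s) * v s →
      |(s + a) - √3 / airyAlpha * v (-a) ^ 2 * exp (-(4 / 3 * q ^ 3) + 2 * a * q)|
        ≤ C / q * exp (-(4 / 3 * q ^ 3) + 2 * a * q) := by
  have hα := airyAlpha_pos
  have hW := canonical_wronskian hu huAiry hv hvAiry hu0 hu'0 hv0 hv'0
  have hvneg : ∀ x ∈ Ico (-a) 0, v x < 0 := fun x hx ↦
    canonical_v_neg hu huAiry hv hvAiry hu0 hu'0 hv0 hv'0 ha haz hane hx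
  have hvc : Continuous v := continuous_iff_continuousAt.2 fun z ↦ (hv z).continuousAt
  have hvc' : Continuous v' := continuous_iff_continuousAt.2 fun z ↦ (hvAiry z).continuousAt
  obtain ⟨M, Y, hM, hY, hgap⟩ := canonical_ratio_gap hu huAiry hv hvAiry hu0 hu'0 hv0 hv'0
  obtain ⟨V, hV⟩ := (isCompact_Icc (a := -a) (b := 0)).exists_bound_of_continuousOn
    (hvc.pow 2).continuousOn
  obtain ⟨L, hL⟩ := (isCompact_Icc (a := -a) (b := 0)).exists_bound_of_continuousOn
    ((continuous_const (y := (2:ℝ))).mul (hvc.mul hvc')).continuousOn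
  have hV0 : 0 ≤ V := (norm_nonneg _).trans (hV 0 ⟨by linarith, le_rfl⟩)
  have hL0 : 0 ≤ L := (norm_nonneg _).trans (hL 0 ⟨by linarith, le_rfl⟩)
  set κ := √3 / airyAlpha with hκ
  have hκ0 : 0 < κ := div_pos (sqrt_pos.2 (by norm_num)) hα
  set v1 := v (-a) ^ 2 with hv1
  have hv10 : 0 ≤ v1 := sq_nonneg _
  have hv1V : v1 ≤ V := (le_abs_self _).trans (hV (-a) ⟨le_rfl, by linarith⟩)
  set Q := Y + 2 * a with hQ
  have hQ1 : 1 ≤ Q := by linarith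
  set T0 := exp (-(4 / 3 * Q ^ 3)) with hT0
  have hT0pos : 0 < T0 := exp_pos _
  set C1 := M * V + (κ + M) ^ 2 * V * L with hC1
  set C2 := (κ + M) * V with hC2
  have hC10 : 0 ≤ C1 := by positivity
  have hC20 : 0 ≤ C2 := by positivity
  clear_value κ v1 Q T0 C1 C2
  refine ⟨(a / T0 + κ * v1) * Q + (2 * C1 + κ * V * (16 * C2 + 4 / 3 * a ^ 2)), by positivity,
    fun q s hq has hs heq ↦ ?_⟩
  set T := exp (-(4 / 3 * q ^ 3) + 2 * a * q) with hT
  have hTpos : 0 < T := exp_pos _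
  set A := (a / T0 + κ * v1) * Q with hA
  set B := 2 * C1 + κ * V * (16 * C2 + 4 / 3 * a ^ 2) with hB
  have hA0 : 0 ≤ A := by positivity
  have hB0 : 0 ≤ B := by positivity
  clear_value T A B
  rcases lt_or_ge q Q with hqQ | hqQ
  · have hTT : T0 ≤ T := by
      rw [hT0, hT]
      refine exp_le_exp.2 ?_
      have : q ^ 3 ≤ Q ^ 3 := pow_le_pow_left₀ hq.le hqQ.le 3
      have : 0 ≤ 2 * a * q := by positivity
      linarith
    have h1 : |s + a - κ * v1 * T| ≤ a + κ * v1 * T := by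
      have : 0 ≤ κ * v1 * T := by positivity
      rw [abs_le]
      constructor <;> linarith
    have h2 : a ≤ a / T0 * T := by
      rw [div_mul_eq_mul_div, le_div_iff₀ hT0pos]
      exact mul_le_mul_of_nonneg_left hTT ha.le
    have h3 : 1 ≤ Q / q := (one_le_div hq).2 hqQ.le
    calc |s + a - κ * v1 * T| ≤ (a / T0 + κ * v1) * T * 1 := by linarith
      _ ≤ (a / T0 + κ * v1) * T * (Q / q) := by gcongr
      _ = A / q * T := by
          rw [hA]
          ring
      _ ≤ (A + B) / q * T := by
          gcongr
          linarith
  · have hq1 : 1 ≤ q := hQ1.trans hqQ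
    set y := q ^ 2 + s with hy
    have hqq : q ≤ q ^ 2 := le_self_pow₀ hq1 two_ne_zero
    have hyY : Y ≤ y := by linarith
    have hy1 : 1 ≤ y := hY.trans hyY
    obtain ⟨hv'pos, hg⟩ := hgap y hyY
    set p := √y with hp
    have hp1 : 1 ≤ p := one_le_sqrt.2 hy1
    have hp0 : 0 < p := by linarith
    have hp2 : p ^ 2 = q ^ 2 + s := sq_sqrt (by linarith)
    have hpq : q / 2 ≤ p := by
      refine le_sqrt_of_sq_le ?_
      rw [div_pow]
      linarith
    have he : exp (-2 * airyZeta y) = exp (-(4 / 3 * p ^ 3)) := by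
      congr 1
      rw [airyZeta, ← hp, show p ^ 3 = p ^ 2 * p by ring, hp2, ← hy]
      ring
    rw [he] at hg
    set e := exp (-(4 / 3 * p ^ 3)) with he_def
    have he0 : 0 < e := exp_pos _
    clear_value e
    have hep3 : e ≤ 1 / p ^ 3 := by
      rw [he_def]
      exact exp_neg_four_thirds_cube_le hp0
    have hep : e ≤ 1 / p := hep3.trans (one_div_le_one_div_of_le hp0 (le_self_pow₀ hp1 three_ne_zero))
    have heq3 : e ≤ 8 / q ^ 3 := by
      refine hep3.trans ?_
      rw [div_le_div_iff₀ (by positivity) (by positivity)]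
      have : (q / 2) ^ 3 ≤ p ^ 3 := pow_le_pow_left₀ (by positivity) hpq 3
      linarith [show (q / 2) ^ 3 = q ^ 3 / 8 by ring]
    have hsneg : v s < 0 := hvneg s ⟨has.le, hs⟩
    have hratio : u' y / v' y = u s / v s := by
      rw [div_eq_div_iff hv'pos.ne' hsneg.ne]
      linarith
    set D := 1 / airyAlpha - u' y / v' y with hD
    obtain ⟨ξ, hξ, hslope⟩ := exists_hasDerivAt_eq_slope (fun z ↦ u z / v z)
      (fun z ↦ -(1 / v z ^ 2)) has
      (fun z hz ↦ ((hu z).div (hv z)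
        (hvneg z ⟨hz.1, hz.2.trans_lt hs⟩).ne).continuousAt.continuousWithinAt)
      (fun z hz ↦ ((hu z).div (hv z) (hvneg z ⟨hz.1.le, hz.2.trans hs⟩).ne).congr_deriv (by
        rw [← neg_div]
        congr 1
        linarith [hW z]))
    have hvξ : v ξ < 0 := hvneg ξ ⟨hξ.1.le, hξ.2.trans hs⟩
    have hva : v (-a) < 0 := hvneg (-a) ⟨le_rfl, by linarith⟩
    have hua : u (-a) / v (-a) = 1 / airyAlpha := by
      rw [div_eq_div_iff hva.ne hα.ne']
      linarith
    set δ := s + a with hδ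
    have hδ0 : 0 < δ := by linarith
    have hδD : δ = D * v ξ ^ 2 := by
      rw [hua, ← hratio, sub_neg_eq_add, ← hδ] at hslope
      rw [eq_div_iff hδ0.ne'] at hslope
      have hinv : 1 / v ξ ^ 2 * v ξ ^ 2 = 1 := one_div_mul_cancel (pow_ne_zero 2 hvξ.ne)
      rw [hD]
      linear_combination -v ξ ^ 2 * hslope - δ * hinv
    have hwξV : v ξ ^ 2 ≤ V := (le_abs_self _).trans (hV ξ ⟨hξ.1.le, by linarith [hξ.2]⟩)
    clear_value D
    have hw : |v ξ ^ 2 - v1| ≤ L * δ := by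
      have h1 := (convex_Icc (-a) 0).norm_image_sub_le_of_norm_hasDerivWithin_le
        (f := fun z ↦ v z ^ 2) (f' := fun z ↦ 2 * (v z * v' z)) (C := L)
        (fun z _ ↦ (((hv z).pow 2).congr_deriv (by
          simp only [Nat.cast_ofNat]
          ring)).hasDerivWithinAt) hL
        (x := -a) (y := ξ) ⟨le_rfl, by linarith⟩ ⟨hξ.1.le, by linarith [hξ.2]⟩
      rw [hv1]
      refine h1.trans (mul_le_mul_of_nonneg_left ?_ hL0)
      rw [norm_eq_abs, abs_of_pos (by linarith [hξ.1])]
      linarith [hξ.2]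
    have hDe : |D| ≤ (κ + M) * e := by
      have h1 : M / p * e ≤ M * e :=
        mul_le_mul_of_nonneg_right (div_le_self hM hp1) he0.le
      have h2 := abs_add_le (D - κ * e) (κ * e)
      rw [sub_add_cancel, abs_of_pos (mul_pos hκ0 he0)] at h2
      linarith
    have hδe : δ ≤ C2 * e := by
      calc δ = D * v ξ ^ 2 := hδD
        _ ≤ |D| * v ξ ^ 2 := mul_le_mul_of_nonneg_right (le_abs_self _) (sq_nonneg _)
        _ ≤ ((κ + M) * e) * V := by gcongr
        _ = C2 * e := by
            rw [hC2]
            ring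
    have hmain : |δ - κ * v1 * e| ≤ C1 / p * e := by
      have e1 : δ - κ * v1 * e = (D - κ * e) * v1 + D * (v ξ ^ 2 - v1) := by
        rw [hδD]
        ring
      rw [e1]
      calc |(D - κ * e) * v1 + D * (v ξ ^ 2 - v1)|
          ≤ |D - κ * e| * v1 + |D| * |v ξ ^ 2 - v1| := by
            refine (abs_add_le _ _).trans ?_
            rw [abs_mul, abs_mul, abs_of_nonneg hv10]
        _ ≤ (M / p * e) * V + ((κ + M) * e) * (L * (C2 * (1 / p))) := by
            have : δ ≤ C2 * (1 / p) := hδe.trans (mul_le_mul_of_nonneg_left hep hC20)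
            have : L * δ ≤ L * (C2 * (1 / p)) := mul_le_mul_of_nonneg_left this hL0
            have := hw.trans this
            gcongr
        _ = C1 / p * e := by
            rw [hC1, hC2]
            ring
    obtain ⟨hR0, hR1⟩ := cube_sub_cube_bounds hp0.le hq hp2
    set R := p ^ 3 - q ^ 3 - 3 / 2 * s * q with hR
    set X := 2 * δ * q + 4 / 3 * R with hX
    have hX0 : 0 ≤ X := by positivity
    have heT : e = T * exp (-X) := by
      rw [he_def, hT, ← exp_add]
      congr 1
      rw [hX, hδ, hR]
      ring
    have heT1 : e ≤ T := by
      rw [heT]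
      exact mul_le_of_le_one_right hTpos.le (exp_le_one_iff.2 (by linarith))
    have hXle : X ≤ (16 * C2 + 4 / 3 * a ^ 2) / q := by
      have h1 : δ * q ≤ C2 * (8 / q ^ 3) * q := by
        gcongr
        exact hδe.trans (mul_le_mul_of_nonneg_left heq3 hC20)
      have h2 : C2 * (8 / q ^ 3) * q ≤ 8 * C2 / q := by
        have : C2 * (8 / q ^ 3) * q = 8 * C2 / q ^ 2 := by field_simp
        rw [this]
        exact div_le_div_of_nonneg_left (by positivity) hq hqq
      have h3 : R ≤ a ^ 2 / q := hR1.trans (by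
        gcongr ?_ / q
        exact sq_le_sq' (by linarith) (by linarith))
      have : (16 * C2 + 4 / 3 * a ^ 2) / q = 2 * (8 * C2 / q) + 4 / 3 * (a ^ 2 / q) := by ring
      rw [hX]
      linarith
    have hTe : T - e ≤ T * X := by
      have h1 := add_one_le_exp (-X)
      have h2 := mul_le_mul_of_nonneg_left h1 hTpos.le
      rw [← heT] at h2
      linarith
    have hpinv : C1 / p * e ≤ 2 * C1 / q * T := by
      have h1 : C1 / p ≤ 2 * C1 / q := by
        rw [div_le_div_iff₀ hp0 hq]
        linarith [mul_le_mul_of_nonneg_left hpq hC10]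
      exact mul_le_mul h1 heT1 he0.le (by positivity)
    calc |δ - κ * v1 * T| = |(δ - κ * v1 * e) - κ * v1 * (T - e)| := by
          congr 1
          ring
      _ ≤ |δ - κ * v1 * e| + |κ * v1 * (T - e)| := abs_sub _ _
      _ ≤ 2 * C1 / q * T + κ * V * (T * ((16 * C2 + 4 / 3 * a ^ 2) / q)) := by
          rw [abs_of_nonneg (by
            have : 0 ≤ T - e := by linarith
            positivity : 0 ≤ κ * v1 * (T - e))]
          have h1 : T - e ≤ T * ((16 * C2 + 4 / 3 * a ^ 2) / q) :=
            hTe.trans (mul_le_mul_of_nonneg_left hXle hTpos.le)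
          have h2 : κ * v1 * (T - e) ≤ κ * V * (T * ((16 * C2 + 4 / 3 * a ^ 2) / q)) :=
            mul_le_mul (mul_le_mul_of_nonneg_left hv1V hκ0.le) h1 (by linarith) (by positivity)
          linarith
      _ = B / q * T := by
          rw [hB]
          ring
      _ ≤ (A + B) / q * T := by
          gcongr
          linarith

end Canonical

theorem stmt_12 (u v u' v' : ℝ → ℝ)
    (hu : ∀ x, HasDerivAt u (u' x) x)
    (huAiry : ∀ x, HasDerivAt u' (x * u x) x)
    (hv : ∀ x, HasDerivAt v (v' x) x)
    (hvAiry : ∀ x, HasDerivAt v' (x * v x) x)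
    (hu0 : u 0 = 1) (hu'0 : u' 0 = 0) (hv0 : v 0 = 0) (hv'0 : v' 0 = 1)
    (a1 : ℝ) (ha1pos : 0 < a1)
    (ha1z : AiF u v (-a1) = 0)
    (ha1ne : ∀ x : ℝ, -a1 < x → AiF u v x ≠ 0)
    (ct0 : ℝ) (hct0pos : 0 < ct0)
    (hct0z : u (-ct0) = 0)
    (hct0ne : ∀ x : ℝ, -ct0 < x → u x ≠ 0) :
    ∀ τ : ℝ, 0 < τ → ∃ C : ℝ, 0 < C ∧
      ∀ h : ℝ, h ∈ Ioc (0:ℝ) ((a1 + τ) ^ (-(3:ℝ)/2)) →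
        ∀ E : ℝ, E ≤ 0 →
          -a1 < -(h ^ (-(2:ℝ)/3)) - E → -(h ^ (-(2:ℝ)/3)) - E ≤ -ct0 →
          v' (-E) * u (-(h ^ (-(2:ℝ)/3)) - E)
            = u' (-E) * v (-(h ^ (-(2:ℝ)/3)) - E) →
          |E + h ^ (-(2:ℝ)/3) - a1
              + Real.sqrt 3 * airyAlpha * (u (-a1)) ^ 2
                * Real.exp (-4/(3*h) + 2 * a1 * h ^ (-(1:ℝ)/3))|
            ≤ C * h ^ ((1:ℝ)/3) * Real.exp (-4/(3*h) + 2 * a1 * h ^ (-(1:ℝ)/3)) := by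
  have hα := airyAlpha_pos
  have hpre : 1 / ((3:ℝ) ^ ((1:ℝ) / 3) * Real.Gamma (1 / 3)) ≠ 0 := by
    have : 0 < Real.Gamma (1 / 3) := Gamma_pos_of_pos (by norm_num)
    positivity
  have haz : airyAlpha * u (-a1) = v (-a1) := by
    rw [AiF_eq] at ha1z
    linarith [(mul_eq_zero.1 ha1z).resolve_left hpre]
  have hane : ∀ x, -a1 < x → airyAlpha * u x - v x ≠ 0 := fun x hx h0 ↦
    ha1ne x hx (by rw [AiF_eq, h0, mul_zero])
  obtain ⟨C, hC, hmain⟩ := canonical_edge_asymptotics hu huAiry hv hvAiry hu0 hu'0 hv0 hv'0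
    ha1pos haz hane
  intro τ _
  refine ⟨C, hC, fun h hh E _ hlow hup heq ↦ ?_⟩
  have hh0 : 0 < h := hh.1
  set q := h ^ (-(1:ℝ) / 3) with hq
  have hq0 : 0 < q := rpow_pos_of_pos hh0 _
  have hq2 : h ^ (-(2:ℝ) / 3) = q ^ 2 :=
    rpow_eq_pow_of_mul_eq 2 hh0.le (by norm_num)
  have hq3 : -4 / (3 * h) = -(4 / 3 * q ^ 3) := by
    rw [hq, ← rpow_eq_pow_of_mul_eq (p := -1) 3 hh0.le (by norm_num), rpow_neg_one]
    field_simp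
  have hqinv : h ^ ((1:ℝ) / 3) = 1 / q := by
    rw [hq, eq_div_iff (rpow_pos_of_pos hh0 _).ne', ← rpow_add hh0]
    norm_num
  rw [hq2] at hlow hup heq ⊢
  rw [hq3, hqinv]
  have hy : -E = q ^ 2 + (-(q ^ 2) - E) := by ring
  have hfin := hmain q (-(q ^ 2) - E) hq0 hlow (by linarith) (by rwa [← hy])
  have hconst : √3 / airyAlpha * v (-a1) ^ 2 = √3 * airyAlpha * u (-a1) ^ 2 := by
    rw [← haz]
    field_simp
  rw [hconst, ← abs_neg] at hfin
  convert hfin using 2 <;> ring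
end

section
/- (Even case) Suppose A > T > 0 satisfy Ai(−A) = 0, u(−T) = 0, and Ai(x) ≠ 0 and u(x) ≠ 0 for every x in (−A, −T) (so −A is a zero a_{j+1} of Ai and −T is the adjacent zero c̃_{2j} of u). Then for every c ≥ T there exists a unique real E with E ≤ 0, −A < −c − E ≤ −T, and v'(−E)·u(−c−E) = u'(−E)·v(−c−E); moreover −c + T ≤ E < −c + A. (Odd case) Suppose A' > T' > 0 satisfy Ai'(−A') = 0, u'(−T') = 0, and Ai'(x) ≠ 0 and u'(x) ≠ 0 for every x in (−A', −T') (so −A' is a zero ã_{j+2} of Ai' and −T' is the adjacent negative zero c̃_{2j+1} of u'). Then for every c ≥ T' there exists a unique real E with E ≤ 0, −A' < −c − E ≤ −T', and u'(−c−E)·v'(−E) = v'(−c−E)·u'(−E); moreover −c + T' ≤ E < −c + A'. (These solutions are the rescaled lower band edges E^{k+1}_min of the periodic Airy–Schrödinger operator.) -/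
open Real Set

/-- Derivative of the standard Airy function in the same basis. -/
noncomputable def AiD (u' v' : ℝ → ℝ) (x : ℝ) : ℝ :=
  u' x / ((3:ℝ) ^ ((2:ℝ)/3) * Real.Gamma (2/3))
    - v' x / ((3:ℝ) ^ ((1:ℝ)/3) * Real.Gamma (1/3))

/-- The `m`-th moment `∫ tᵐ exp(-t³/3 - x³/(3t³)) dt` over `(0, ∞)`. For `m = 0` it is a multiple of
the decaying solution of the Airy equation on `[0, ∞)`, and for `m = 1` of minus its derivative. -/
noncomputable def airyMoment (m : ℕ) (x : ℝ) : ℝ :=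
  ∫ t in Ioi (0 : ℝ), t ^ m * Real.exp (-(t ^ 3 / 3) - x ^ 3 / (3 * t ^ 3))

open MeasureTheory in
theorem integrableOn_pow_mul_exp_neg_cube (m : ℕ) :
    IntegrableOn (fun t : ℝ => t ^ m * Real.exp (-(t ^ 3 / 3))) (Ioi 0) := by
  have h := integrableOn_rpow_mul_exp_neg_mul_rpow (p := 3) (s := m) (b := 1 / 3)
    (by have := m.cast_nonneg (α := ℝ); linarith) (by norm_num) (by norm_num)
  refine h.congr_fun (fun t _ => ?_) measurableSet_Ioi
  simp only [Real.rpow_natCast]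
  norm_cast
  congr 2
  ring

theorem airyMoment_zero_right (m : ℕ) :
    airyMoment m 0 = (3 : ℝ) ^ (((m : ℝ) + 1) / 3) * Real.Gamma ((m + 1) / 3) / 3 := by
  have h := integral_rpow_mul_exp_neg_mul_rpow (p := 3) (q := m) (b := 1 / 3)
    (by norm_num) (by have := m.cast_nonneg (α := ℝ); linarith) (by norm_num)
  have e : airyMoment m 0 = ∫ t in Ioi (0 : ℝ), t ^ (m : ℝ) * Real.exp (-(1 / 3) * t ^ (3 : ℝ)) := by
    refine MeasureTheory.setIntegral_congr_fun measurableSet_Ioi (fun t _ => ?_)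
    simp only [Real.rpow_natCast]
    norm_cast
    congr 2
    ring
  rw [e, h, one_div, Real.inv_rpow (by norm_num), neg_div, Real.rpow_neg (by norm_num), inv_inv]
  ring

open MeasureTheory in
theorem integrableOn_airyMoment (m : ℕ) {x : ℝ} (hx : 0 ≤ x) :
    IntegrableOn (fun t : ℝ => t ^ m * Real.exp (-(t ^ 3 / 3) - x ^ 3 / (3 * t ^ 3))) (Ioi 0) := by
  refine (integrableOn_pow_mul_exp_neg_cube m).mono' (by fun_prop) ?_
  filter_upwards [ae_restrict_mem measurableSet_Ioi] with t (ht : 0 < t)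
  rw [Real.norm_of_nonneg (by positivity)]
  gcongr
  have : 0 ≤ x ^ 3 / (3 * t ^ 3) := by positivity
  linarith

theorem airyMoment_pos (m : ℕ) {x : ℝ} (hx : 0 ≤ x) : 0 < airyMoment m x := by
  refine (MeasureTheory.setIntegral_pos_iff_support_of_nonneg_ae ?_
    (integrableOn_airyMoment m hx)).2 ?_
  · filter_upwards [MeasureTheory.ae_restrict_mem measurableSet_Ioi] with t (ht : 0 < t)
    simp only [Pi.zero_apply]
    positivity
  · have : Ioi (0 : ℝ) ⊆ Function.support
        (fun t : ℝ => t ^ m * Real.exp (-(t ^ 3 / 3) - x ^ 3 / (3 * t ^ 3))) ∩ Ioi 0 :=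
      fun t (ht : 0 < t) => ⟨by simp only [Function.mem_support]; positivity, ht⟩
    exact lt_of_lt_of_le (by simp) (MeasureTheory.measure_mono this)

theorem continuousOn_airyMoment (m : ℕ) : ContinuousOn (airyMoment m) (Ici 0) := by
  refine MeasureTheory.continuousOn_of_dominated (fun x _ => by fun_prop) (fun x (hx : 0 ≤ x) => ?_)
    (integrableOn_pow_mul_exp_neg_cube m) ?_
  · filter_upwards [MeasureTheory.ae_restrict_mem measurableSet_Ioi] with t (ht : 0 < t)
    rw [Real.norm_of_nonneg (by positivity)]
    gcongr
    have : 0 ≤ x ^ 3 / (3 * t ^ 3) := by positivity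
    linarith
  · exact Filter.Eventually.of_forall fun t => by fun_prop

/-- The substitution `t = x / w` in the moment integrals. -/
theorem integral_pow_div_cube_mul_exp {m : ℕ} (hm : m ≤ 1) {x : ℝ} (hx : 0 < x) :
    ∫ t in Ioi (0 : ℝ), t ^ m * (x ^ 2 / t ^ 3) * Real.exp (-(t ^ 3 / 3) - x ^ 3 / (3 * t ^ 3))
      = x ^ m * airyMoment (1 - m) x := by
  have himage : (fun w : ℝ => x / w) '' Ioi 0 = Ioi 0 := by
    ext t
    constructor
    · rintro ⟨w, hw : 0 < w, rfl⟩
      exact div_pos hx hw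
    · intro (ht : 0 < t)
      exact ⟨x / t, div_pos hx ht, by simp only; field_simp⟩
  have hderiv : ∀ w ∈ Ioi (0 : ℝ),
      HasDerivWithinAt (fun w : ℝ => x / w) (-(x / w ^ 2)) (Ioi 0) w := by
    intro w (hw : 0 < w)
    have := ((hasDerivAt_inv hw.ne').const_mul x).hasDerivWithinAt (s := Ioi 0)
    exact this.congr_deriv (by ring)
  have hinj : InjOn (fun w : ℝ => x / w) (Ioi 0) := by
    intro w (hw : 0 < w) w' (hw' : 0 < w') h
    simp only at h
    field_simp at h
    exact h.symm
  have h := MeasureTheory.integral_image_eq_integral_abs_deriv_smul measurableSet_Ioi hderiv hinj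
    (fun t => t ^ m * (x ^ 2 / t ^ 3) * Real.exp (-(t ^ 3 / 3) - x ^ 3 / (3 * t ^ 3)))
  rw [himage] at h
  rw [h, airyMoment, ← MeasureTheory.integral_const_mul]
  refine MeasureTheory.setIntegral_congr_fun measurableSet_Ioi (fun w (hw : 0 < w) => ?_)
  have hexp : -((x / w) ^ 3 / 3) - x ^ 3 / (3 * (x / w) ^ 3)
      = -(w ^ 3 / 3) - x ^ 3 / (3 * w ^ 3) := by
    field_simp
    ring
  simp only [smul_eq_mul, hexp, abs_neg, abs_of_pos (div_pos hx (pow_pos hw 2))]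
  interval_cases m <;> field_simp <;> simp

theorem hasDerivAt_airyMoment {m : ℕ} (hm : m ≤ 1) {x : ℝ} (hx : 0 < x) :
    HasDerivAt (airyMoment m) (-(x ^ m * airyMoment (1 - m) x)) x := by
  have key := hasDerivAt_integral_of_dominated_loc_of_deriv_le
    (μ := MeasureTheory.volume.restrict (Ioi (0 : ℝ)))
    (F := fun x t => t ^ m * Real.exp (-(t ^ 3 / 3) - x ^ 3 / (3 * t ^ 3)))
    (F' := fun x t =>
      -(t ^ m * (x ^ 2 / t ^ 3) * Real.exp (-(t ^ 3 / 3) - x ^ 3 / (3 * t ^ 3))))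
    (x₀ := x) (s := Ioi (x / 2))
    (bound := fun t => 6 / x * (t ^ m * Real.exp (-(t ^ 3 / 3))))
    (Ioi_mem_nhds (by linarith)) (Filter.Eventually.of_forall fun _ => by fun_prop)
    (integrableOn_airyMoment m hx.le) (by fun_prop) ?_
    ((integrableOn_pow_mul_exp_neg_cube m).const_mul _) ?_
  · have h := key.2
    rw [MeasureTheory.integral_neg, integral_pow_div_cube_mul_exp hm hx] at h
    exact h
  · filter_upwards [MeasureTheory.ae_restrict_mem measurableSet_Ioi] with t (ht : 0 < t) y
      (hy : x / 2 < y)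
    have hy0 : 0 < y := by linarith
    rw [norm_neg, Real.norm_of_nonneg (by positivity), sub_eq_add_neg, Real.exp_add]
    have h1 : y ^ 2 / t ^ 3 * Real.exp (-(y ^ 3 / (3 * t ^ 3))) ≤ 6 / x := by
      have h2 : y ^ 3 / (3 * t ^ 3) ≤ Real.exp (y ^ 3 / (3 * t ^ 3)) := by
        linarith [Real.add_one_le_exp (y ^ 3 / (3 * t ^ 3))]
      have h3 : y ^ 2 / t ^ 3 = 3 / y * (y ^ 3 / (3 * t ^ 3)) := by field_simp
      have h4 : 3 / y ≤ 6 / x := by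
        rw [div_le_div_iff₀ hy0 hx]
        linarith
      rw [Real.exp_neg, ← div_eq_mul_inv, div_le_iff₀ (Real.exp_pos _), h3]
      gcongr
    calc _ = (t ^ m * Real.exp (-(t ^ 3 / 3))) *
          (y ^ 2 / t ^ 3 * Real.exp (-(y ^ 3 / (3 * t ^ 3)))) := by ring
      _ ≤ (t ^ m * Real.exp (-(t ^ 3 / 3))) * (6 / x) := by gcongr
      _ = _ := by ring
  · refine Filter.Eventually.of_forall fun t y _ => ?_
    have h := ((((hasDerivAt_pow 3 y).div_const (3 * t ^ 3)).const_sub (-(t ^ 3 / 3))).exp).const_mul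
      (t ^ m)
    refine h.congr_deriv ?_
    rw [show ((3 : ℕ) : ℝ) * y ^ (3 - 1) / (3 * t ^ 3) = y ^ 2 / t ^ 3 by
      norm_num [mul_div_mul_left]]
    ring

/-- For a solution `f` of the Airy equation, its Wronskian with the decaying solution is constant
on `[0, ∞)`. -/
theorem airyMoment_wronskian {f f' : ℝ → ℝ} (hf : ∀ x, HasDerivAt f (f' x) x)
    (hf' : ∀ x, HasDerivAt f' (x * f x) x) {s : ℝ} (hs : 0 ≤ s) :
    airyMoment 0 s * f' s + airyMoment 1 s * f s
      = airyMoment 0 0 * f' 0 + airyMoment 1 0 * f 0 := by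
  have cf : Continuous f := continuous_iff_continuousAt.2 fun x => (hf x).continuousAt
  have cf' : Continuous f' := continuous_iff_continuousAt.2 fun x => (hf' x).continuousAt
  obtain rfl | hs := hs.eq_or_lt
  · rfl
  obtain ⟨x, -, hx⟩ := exists_hasDerivAt_eq_slope
    (fun y => airyMoment 0 y * f' y + airyMoment 1 y * f y) (fun _ => 0) hs
    ((((continuousOn_airyMoment 0).mono Icc_subset_Ici_self).mul cf'.continuousOn).add
      (((continuousOn_airyMoment 1).mono Icc_subset_Ici_self).mul cf.continuousOn))
    (fun y hy => by
      refine (((hasDerivAt_airyMoment zero_le_one hy.1).mul (hf' y)).add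
        ((hasDerivAt_airyMoment le_rfl hy.1).mul (hf y))).congr_deriv ?_
      simp only [pow_zero, pow_one, Nat.sub_zero, Nat.sub_self]
      ring)
  rw [eq_comm, div_eq_zero_iff] at hx
  rcases hx with hx | hx <;> linarith

theorem airy_wronskian {u v u' v' : ℝ → ℝ}
    (hu : ∀ x, HasDerivAt u (u' x) x) (huAiry : ∀ x, HasDerivAt u' (x * u x) x)
    (hv : ∀ x, HasDerivAt v (v' x) x) (hvAiry : ∀ x, HasDerivAt v' (x * v x) x)
    (hu0 : u 0 = 1) (hu'0 : u' 0 = 0) (hv'0 : v' 0 = 1) (x : ℝ) :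
    u x * v' x - u' x * v x = 1 := by
  have hd (y : ℝ) : HasDerivAt (fun y => u y * v' y - u' y * v y) 0 y := by
    refine (((hu y).mul (hvAiry y)).sub ((huAiry y).mul (hv y))).congr_deriv ?_
    ring
  have h := is_const_of_deriv_eq_zero (fun y => (hd y).differentiableAt) (fun y => (hd y).deriv) x 0
  simpa [hu0, hu'0, hv'0] using h

/-- The canonical solution `u` is strictly increasing on `(0, ∞)`. -/
theorem airy_deriv_pos_of_pos {u u' : ℝ → ℝ}
    (hu : ∀ x, HasDerivAt u (u' x) x) (huAiry : ∀ x, HasDerivAt u' (x * u x) x)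
    (hu0 : u 0 = 1) (hu'0 : u' 0 = 0) {s : ℝ} (hs : 0 < s) : 0 < u' s := by
  have hprod (y : ℝ) : HasDerivAt (fun y => u y * u' y) (u' y ^ 2 + y * u y ^ 2) y := by
    refine ((hu y).mul (huAiry y)).congr_deriv ?_
    ring
  have cu : Continuous u := continuous_iff_continuousAt.2 fun x => (hu x).continuousAt
  have cu' : Continuous u' := continuous_iff_continuousAt.2 fun x => (huAiry x).continuousAt
  have hmul : ∀ y, 0 ≤ y → 0 ≤ u y * u' y := by
    have hmono : MonotoneOn (fun y => u y * u' y) (Ici 0) := by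
      refine monotoneOn_of_hasDerivWithinAt_nonneg (convex_Ici 0) (cu.mul cu').continuousOn
        (fun y _ => (hprod y).hasDerivWithinAt) fun y hy => ?_
      rw [interior_Ici] at hy
      have : 0 < y := hy
      positivity
    intro y hy
    simpa [hu'0] using hmono (mem_Ici.2 le_rfl) (mem_Ici.2 hy) hy
  have hsq : ∀ y, 0 ≤ y → 1 ≤ u y ^ 2 := by
    have hmono : MonotoneOn (fun y => u y ^ 2) (Ici 0) := by
      refine monotoneOn_of_hasDerivWithinAt_nonneg (convex_Ici 0) (cu.pow 2).continuousOn
        (fun y _ => ((hu y).pow 2).hasDerivWithinAt) fun y hy => ?_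
      rw [interior_Ici] at hy
      have := hmul y (le_of_lt hy)
      norm_num
      linarith
    intro y hy
    simpa [hu0] using hmono (mem_Ici.2 le_rfl) (mem_Ici.2 hy) hy
  have hpos : ∀ y, 0 ≤ y → 0 < u y := by
    intro y hy
    by_contra! hneg
    obtain ⟨z, hz, hz0⟩ := intermediate_value_Icc' hy cu.continuousOn
      (show (0 : ℝ) ∈ Icc (u y) (u 0) from ⟨hneg, by simp [hu0]⟩)
    have := hsq z hz.1
    norm_num [hz0] at this
  have hmono : StrictMonoOn u' (Ici 0) := by
    refine strictMonoOn_of_hasDerivWithinAt_pos (convex_Ici 0) cu'.continuousOn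
      (fun y _ => (huAiry y).hasDerivWithinAt) fun y hy => ?_
    rw [interior_Ici] at hy
    exact mul_pos hy (hpos y (le_of_lt hy))
  simpa [hu'0] using hmono (mem_Ici.2 le_rfl) (mem_Ici.2 hs.le) hs

theorem strictAntiOn_airy_deriv_quotient {u v u' v' : ℝ → ℝ}
    (huAiry : ∀ x, HasDerivAt u' (x * u x) x) (hvAiry : ∀ x, HasDerivAt v' (x * v x) x)
    (hW : ∀ x, u x * v' x - u' x * v x = 1) (hpos : ∀ s, 0 < s → 0 < u' s) :
    StrictAntiOn (fun s => v' s / u' s) (Ioi 0) := by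
  have hd : ∀ s ∈ Ioi (0 : ℝ), HasDerivAt (fun s => v' s / u' s) (-s / u' s ^ 2) s := by
    intro s hs
    refine ((hvAiry s).div (huAiry s) (hpos s hs).ne').congr_deriv ?_
    congr 1
    linear_combination (-s) * hW s
  refine strictAntiOn_of_hasDerivWithinAt_neg (f' := fun s => -s / u' s ^ 2) (convex_Ioi 0)
    (fun s hs => (hd s hs).continuousAt.continuousWithinAt)
    (fun s hs => (hd s (interior_subset hs)).hasDerivWithinAt) fun s hs => ?_
  have hs : 0 < s := interior_subset hs
  exact div_neg_of_neg_of_pos (by linarith) (pow_pos (hpos s hs) 2)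

/-- The derivative of the decaying Airy solution is negative on `[0, ∞)`. -/
theorem airy_decaying_deriv_neg {u v u' v' : ℝ → ℝ}
    (hu : ∀ x, HasDerivAt u (u' x) x) (huAiry : ∀ x, HasDerivAt u' (x * u x) x)
    (hv : ∀ x, HasDerivAt v (v' x) x) (hvAiry : ∀ x, HasDerivAt v' (x * v x) x)
    (hu0 : u 0 = 1) (hu'0 : u' 0 = 0) (hv0 : v 0 = 0) (hv'0 : v' 0 = 1) {s : ℝ} (hs : 0 ≤ s) :
    u' s / ((3 : ℝ) ^ ((2 : ℝ) / 3) * Real.Gamma (2 / 3))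
      < v' s / ((3 : ℝ) ^ ((1 : ℝ) / 3) * Real.Gamma (1 / 3)) := by
  have e0 := airyMoment_zero_right 0
  have e1 := airyMoment_zero_right 1
  norm_num at e0 e1
  have h1 := airyMoment_wronskian hu huAiry hs
  have h2 := airyMoment_wronskian hv hvAiry hs
  rw [hu0, hu'0] at h1
  rw [hv0, hv'0] at h2
  have hW := airy_wronskian hu huAiry hv hvAiry hu0 hu'0 hv'0 s
  have hpos := airyMoment_pos 1 hs
  have key : airyMoment 0 0 * u' s < airyMoment 1 0 * v' s := by
    have : airyMoment 1 0 * v' s - airyMoment 0 0 * u' s = airyMoment 1 s := by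
      linear_combination (-v' s) * h1 + u' s * h2 + airyMoment 1 s * hW
    linarith
  rw [e0, e1] at key
  have g1 : 0 < Real.Gamma (1 / 3) := Real.Gamma_pos_of_pos (by norm_num)
  have g2 : 0 < Real.Gamma (2 / 3) := Real.Gamma_pos_of_pos (by norm_num)
  rw [div_lt_div_iff₀ (by positivity) (by positivity)]
  linarith

/-- Existence and uniqueness of a crossing of `q / p`, increasing from `a / b` to `∞`
on `[-A, -T)`, with the decreasing function `s ↦ g s / f s` at `s = y + c`. -/
theorem existsUnique_crossing_of_pos {p q p' q' f g : ℝ → ℝ} {a b A T c : ℝ}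
    (hp : ∀ x, HasDerivAt p (p' x) x) (hq : ∀ x, HasDerivAt q (q' x) x)
    (hD : ∀ x < 0, 0 < p x * q' x - p' x * q x) (ha : 0 < a) (hb : 0 < b)
    (hT : 0 < T) (hTA : T < A) (hA : a * p (-A) = b * q (-A)) (hpT : p (-T) = 0)
    (hpos : ∀ x ∈ Ico (-A) (-T), 0 < p x) (hf : Continuous f) (hg : Continuous g)
    (hf0 : f 0 = 0) (hg0 : 0 < g 0) (hfpos : ∀ s, 0 < s → 0 < f s)
    (hbound : ∀ s, 0 ≤ s → a * f s < b * g s)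
    (hanti : StrictAntiOn (fun s => g s / f s) (Ioi 0)) (hc : T ≤ c) :
    ∃! E : ℝ, E ≤ 0 ∧ -A < -c - E ∧ -c - E ≤ -T ∧ g (-E) * p (-c - E) = f (-E) * q (-c - E) := by
  have cp : Continuous p := continuous_iff_continuousAt.2 fun x => (hp x).continuousAt
  have cq : Continuous q := continuous_iff_continuousAt.2 fun x => (hq x).continuousAt
  have hqT0 : q (-T) ≠ 0 := by
    intro h
    have := hD (-T) (by linarith)
    simp [h, hpT] at this
  have hmono : StrictMonoOn (fun y => q y / p y) (Ico (-A) (-T)) := by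
    have hd : ∀ y ∈ Ico (-A) (-T),
        HasDerivAt (fun y => q y / p y) ((p y * q' y - p' y * q y) / p y ^ 2) y := by
      intro y hy
      refine ((hq y).div (hp y) (hpos y hy).ne').congr_deriv ?_
      ring
    refine strictMonoOn_of_hasDerivWithinAt_pos (f' := fun y => (p y * q' y - p' y * q y) / p y ^ 2)
      (convex_Ico _ _) (fun y hy => (hd y hy).continuousAt.continuousWithinAt)
      (fun y hy => (hd y (interior_subset hy)).hasDerivWithinAt) fun y hy => ?_
    have hy := interior_subset hy
    exact div_pos (hD y (by linarith [hy.2])) (pow_pos (hpos y hy) 2)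
  have hqT : 0 < q (-T) := by
    refine lt_of_le_of_ne ?_ hqT0.symm
    have hnonneg : ∀ y ∈ Ico (-A) (-T), 0 ≤ q y := by
      intro y hy
      have hAmem : -A ∈ Ico (-A) (-T) := ⟨le_rfl, by linarith⟩
      have hqA : 0 < q (-A) := by
        have := mul_pos ha (hpos _ hAmem)
        rw [hA] at this
        exact pos_of_mul_pos_right this hb.le
      have h := hmono.monotoneOn hAmem hy hy.1
      have h1 := (div_pos hqA (hpos _ hAmem)).trans_le h
      exact ((div_pos_iff_of_pos_right (hpos y hy)).1 h1).le
    have hmem : -T ∈ closure (Ico (-A) (-T)) := by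
      rw [closure_Ico (by linarith)]
      exact ⟨by linarith, le_rfl⟩
    exact closure_minimal hnonneg (isClosed_Ici.preimage cq) hmem
  obtain rfl | hc := hc.eq_or_lt
  · refine ⟨0, ⟨le_rfl, by linarith, by linarith, by simp [hpT, hf0]⟩, ?_⟩
    rintro E ⟨h1, -, h2, -⟩
    linarith
  have hinterior : ∀ E, E ≤ 0 → -A < -c - E → -c - E ≤ -T →
      g (-E) * p (-c - E) = f (-E) * q (-c - E) →
      0 < -E ∧ -c - E ∈ Ico (-A) (-T) ∧ q (-c - E) / p (-c - E) = g (-E) / f (-E) := by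
    intro E h1 h2 h3 h4
    have hlt : -c - E < -T := by
      refine lt_of_le_of_ne h3 fun h => ?_
      rw [h, hpT, mul_zero] at h4
      exact (mul_pos (hfpos (-E) (by linarith)) hqT).ne h4
    have hmem : -c - E ∈ Ico (-A) (-T) := ⟨h2.le, hlt⟩
    have hE : 0 < -E := by
      refine lt_of_le_of_ne (by linarith) fun h => ?_
      rw [← h, hf0, zero_mul] at h4
      exact (mul_pos hg0 (hpos _ hmem)).ne' h4
    refine ⟨hE, hmem, ?_⟩
    rw [div_eq_div_iff (hpos _ hmem).ne' (hfpos _ hE).ne']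
    linarith
  have hexists : ∃ y, -A < y ∧ -c ≤ y ∧ y ≤ -T ∧ g (y + c) * p y = f (y + c) * q y := by
    have hstart : 0 < g (max (-A) (-c) + c) * p (max (-A) (-c))
        - f (max (-A) (-c) + c) * q (max (-A) (-c)) := by
      have hmem : max (-A) (-c) ∈ Ico (-A) (-T) :=
        ⟨le_max_left _ _, max_lt (by linarith) (by linarith)⟩
      rcases le_total (-A) (-c) with h | h
      · rw [max_eq_right h] at hmem ⊢
        simpa [hf0] using mul_pos hg0 (hpos _ hmem)
      · rw [max_eq_left h] at hmem ⊢
        have h1 := mul_lt_mul_of_pos_right (hbound (-A + c) (by linarith)) (hpos _ hmem)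
        refine pos_of_mul_pos_right (a := b) ?_ hb.le
        linear_combination h1 - f (-A + c) * hA
    have hend : g (-T + c) * p (-T) - f (-T + c) * q (-T) < 0 := by
      rw [hpT, mul_zero, zero_sub, neg_lt_zero]
      exact mul_pos (hfpos _ (by linarith)) hqT
    obtain ⟨y, hy, hy0⟩ := intermediate_value_Ioo' (f := fun y => g (y + c) * p y - f (y + c) * q y)
      (max_le (by linarith) (by linarith) : max (-A) (-c) ≤ -T)
      (by fun_prop) (show (0 : ℝ) ∈ Ioo _ _ from ⟨hend, hstart⟩)
    exact ⟨y, (le_max_left _ _).trans_lt hy.1, ((le_max_right _ _).trans_lt hy.1).le, hy.2.le,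
      sub_eq_zero.1 hy0⟩
  obtain ⟨y, hy1, hy2, hy3, hy4⟩ := hexists
  refine existsUnique_of_exists_of_unique ⟨-(y + c), by linarith, ?_⟩ ?_
  · rw [neg_neg, show -c - -(y + c) = y by ring]
    exact ⟨hy1, hy3, hy4⟩
  · have hle : ∀ E F, (E ≤ 0 ∧ -A < -c - E ∧ -c - E ≤ -T ∧
        g (-E) * p (-c - E) = f (-E) * q (-c - E)) → (F ≤ 0 ∧ -A < -c - F ∧ -c - F ≤ -T ∧
        g (-F) * p (-c - F) = f (-F) * q (-c - F)) → E ≤ F := by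
      rintro E F ⟨h1, h2, h3, h4⟩ ⟨k1, k2, k3, k4⟩
      obtain ⟨hE, hEmem, hEeq⟩ := hinterior E h1 h2 h3 h4
      obtain ⟨hF, hFmem, hFeq⟩ := hinterior F k1 k2 k3 k4
      by_contra! hlt
      have m1 := hmono hEmem hFmem (by linarith)
      have m2 := hanti (mem_Ioi.2 hE) (mem_Ioi.2 hF) (by linarith)
      simp only at m1 m2
      linarith
    exact fun E F hE hF => le_antisymm (hle E F hE hF) (hle F E hF hE)

theorem existsUnique_crossing {p q p' q' f g : ℝ → ℝ} {a b A T c : ℝ}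
    (hp : ∀ x, HasDerivAt p (p' x) x) (hq : ∀ x, HasDerivAt q (q' x) x)
    (hD : ∀ x < 0, 0 < p x * q' x - p' x * q x) (ha : 0 < a) (hb : 0 < b)
    (hT : 0 < T) (hTA : T < A) (hA : a * p (-A) = b * q (-A)) (hpT : p (-T) = 0)
    (hne : ∀ x ∈ Ioo (-A) (-T), p x ≠ 0) (hf : Continuous f) (hg : Continuous g)
    (hf0 : f 0 = 0) (hg0 : 0 < g 0) (hfpos : ∀ s, 0 < s → 0 < f s)
    (hbound : ∀ s, 0 ≤ s → a * f s < b * g s)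
    (hanti : StrictAntiOn (fun s => g s / f s) (Ioi 0)) (hc : T ≤ c) :
    ∃! E : ℝ, E ≤ 0 ∧ -A < -c - E ∧ -c - E ≤ -T ∧ g (-E) * p (-c - E) = f (-E) * q (-c - E) := by
  have cp : Continuous p := continuous_iff_continuousAt.2 fun x => (hp x).continuousAt
  have hne' : ∀ x ∈ Ico (-A) (-T), p x ≠ 0 := by
    intro x hx h0
    rcases hx.1.eq_or_lt with rfl | h
    · rw [h0, mul_zero, eq_comm, mul_eq_zero, or_iff_right hb.ne'] at hA
      have := hD (-A) (by linarith)
      simp [h0, hA] at this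
    · exact hne x ⟨h, hx.2⟩ h0
  have hsign : (∀ x ∈ Ico (-A) (-T), 0 < p x) ∨ ∀ x ∈ Ico (-A) (-T), p x < 0 := by
    by_contra! h
    obtain ⟨⟨x, hx, hx0⟩, y, hy, hy0⟩ := h
    obtain ⟨z, hz, hz0⟩ := isPreconnected_Ico.intermediate_value hx hy cp.continuousOn
      (show (0 : ℝ) ∈ Icc (p x) (p y) from ⟨hx0, hy0⟩)
    exact hne' z hz hz0
  rcases hsign with h | h
  · exact existsUnique_crossing_of_pos hp hq hD ha hb hT hTA hA hpT h hf hg hf0 hg0 hfpos hbound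
      hanti hc
  · have := existsUnique_crossing_of_pos (p := fun x => -p x) (q := fun x => -q x)
      (fun x => (hp x).neg) (fun x => (hq x).neg)
      (fun x hx => by linarith [hD x hx]) ha hb hT hTA (by simpa using hA) (by simpa using hpT)
      (fun x hx => by simpa using h x hx) hf hg hf0 hg0 hfpos hbound hanti hc
    simpa only [mul_neg, neg_inj] using this


theorem stmt_13 (u v u' v' : ℝ → ℝ)
    (hu : ∀ x, HasDerivAt u (u' x) x)
    (huAiry : ∀ x, HasDerivAt u' (x * u x) x)
    (hv : ∀ x, HasDerivAt v (v' x) x)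
    (hvAiry : ∀ x, HasDerivAt v' (x * v x) x)
    (hu0 : u 0 = 1) (hu'0 : u' 0 = 0) (hv0 : v 0 = 0) (hv'0 : v' 0 = 1) :
    -- Even case
    (∀ A T : ℝ, 0 < T → T < A →
      AiF u v (-A) = 0 → u (-T) = 0 →
      (∀ x ∈ Ioo (-A) (-T), AiF u v x ≠ 0 ∧ u x ≠ 0) →
      ∀ c : ℝ, T ≤ c →
        (∃! E : ℝ, E ≤ 0 ∧ -A < -c - E ∧ -c - E ≤ -T ∧
          v' (-E) * u (-c - E) = u' (-E) * v (-c - E)) ∧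
        (∀ E : ℝ, (E ≤ 0 ∧ -A < -c - E ∧ -c - E ≤ -T ∧
            v' (-E) * u (-c - E) = u' (-E) * v (-c - E)) →
          -c + T ≤ E ∧ E < -c + A)) ∧
    -- Odd case
    (∀ A' T' : ℝ, 0 < T' → T' < A' →
      AiD u' v' (-A') = 0 → u' (-T') = 0 →
      (∀ x ∈ Ioo (-A') (-T'), AiD u' v' x ≠ 0 ∧ u' x ≠ 0) →
      ∀ c : ℝ, T' ≤ c →
        (∃! E : ℝ, E ≤ 0 ∧ -A' < -c - E ∧ -c - E ≤ -T' ∧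
          u' (-c - E) * v' (-E) = v' (-c - E) * u' (-E)) ∧
        (∀ E : ℝ, (E ≤ 0 ∧ -A' < -c - E ∧ -c - E ≤ -T' ∧
            u' (-c - E) * v' (-E) = v' (-c - E) * u' (-E)) →
          -c + T' ≤ E ∧ E < -c + A')) := by
  have cu' : Continuous u' := continuous_iff_continuousAt.2 fun x => (huAiry x).continuousAt
  have cv' : Continuous v' := continuous_iff_continuousAt.2 fun x => (hvAiry x).continuousAt
  have hW := airy_wronskian hu huAiry hv hvAiry hu0 hu'0 hv'0
  have hu'pos : ∀ s, 0 < s → 0 < u' s := fun s hs => airy_deriv_pos_of_pos hu huAiry hu0 hu'0 hs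
  have hanti := strictAntiOn_airy_deriv_quotient huAiry hvAiry hW hu'pos
  have g1 : 0 < Real.Gamma (1 / 3) := Real.Gamma_pos_of_pos (by norm_num)
  have g2 : 0 < Real.Gamma (2 / 3) := Real.Gamma_pos_of_pos (by norm_num)
  have ha : 0 < ((3 : ℝ) ^ ((2 : ℝ) / 3) * Real.Gamma (2 / 3))⁻¹ := by positivity
  have hb : 0 < ((3 : ℝ) ^ ((1 : ℝ) / 3) * Real.Gamma (1 / 3))⁻¹ := by positivity
  have hbound : ∀ s, 0 ≤ s → ((3 : ℝ) ^ ((2 : ℝ) / 3) * Real.Gamma (2 / 3))⁻¹ * u' s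
      < ((3 : ℝ) ^ ((1 : ℝ) / 3) * Real.Gamma (1 / 3))⁻¹ * v' s := by
    intro s hs
    simpa only [div_eq_inv_mul] using airy_decaying_deriv_neg hu huAiry hv hvAiry hu0 hu'0 hv0 hv'0 hs
  constructor
  · intro A T hT hTA hA huT hne c hc
    refine ⟨?_, fun E hE => ⟨by linarith [hE.2.2.1], by linarith [hE.2.1]⟩⟩
    refine existsUnique_crossing hu hv (fun x _ => by linarith [hW x]) ha hb hT hTA ?_ huT
      (fun x hx => (hne x hx).2) cu' cv' hu'0 (by simp [hv'0]) hu'pos hbound hanti hc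
    simpa only [AiF, div_eq_inv_mul, sub_eq_zero] using hA
  · intro A T hT hTA hA huT hne c hc
    refine ⟨?_, fun E hE => ⟨by linarith [hE.2.2.1], by linarith [hE.2.1]⟩⟩
    have := existsUnique_crossing huAiry hvAiry
      (fun x hx => by linear_combination hx + x * hW x) ha hb hT hTA
      (by simpa only [AiD, div_eq_inv_mul, sub_eq_zero] using hA) huT
      (fun x hx => (hne x hx).2) cu' cv' hu'0 (by simp [hv'0]) hu'pos hbound hanti hc
    simpa only [mul_comm (v' (-_)), mul_comm (u' (-_))] using this
end

section
/- (Even case) Suppose R > B > 0 satisfy v'(−R) = 0, Ai'(−B) = 0, and v'(x) ≠ 0 and Ai'(x) ≠ 0 for every x in (−R, −B) (so −R is a zero c_{2j} of v' and −B is the adjacent zero ã_{j+1} of Ai'). Then for every c ≥ R there exists a unique real E with E ≤ 0, −R ≤ −c − E < −B, and v(−E)·u'(−c−E) = u(−E)·v'(−c−E); moreover −c + B < E ≤ −c + R. (Odd case) Suppose R' > B' > 0 satisfy v(−R') = 0, Ai(−B') = 0, and v(x) ≠ 0 and Ai(x) ≠ 0 for every x in (−R', −B') (so −R' is a negative zero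 c_{2j+1} of v and −B' is the adjacent zero a_{j+1} of Ai). Then for every c ≥ R' there exists a unique real E with E ≤ 0, −R' ≤ −c − E < −B', and u(−E)·v(−c−E) = v(−E)·u(−c−E); moreover −c + B' < E ≤ −c + R'. (These solutions are the rescaled upper band edges E^k_max of the periodic Airy–Schrödinger operator.) -/
open Real Set

open MeasureTheory Filter Topology

/-- The function in the first argument solves the Airy equation, and the second is its derivative. -/
def IsAirySolution (f f' : ℝ → ℝ) : Prop :=
  ∀ x, HasDerivAt f (f' x) x ∧ HasDerivAt f' (x * f x) x

namespace IsAirySolution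

variable {f f' g g' : ℝ → ℝ}

theorem continuous (hf : IsAirySolution f f') : Continuous f :=
  continuous_iff_continuousAt.2 fun x => (hf x).1.continuousAt

theorem linear_comb (hf : IsAirySolution f f') (hg : IsAirySolution g g') (a b : ℝ) :
    IsAirySolution (fun x => a * f x - b * g x) (fun x => a * f' x - b * g' x) := by
  intro x
  refine ⟨((hf x).1.const_mul a).sub ((hg x).1.const_mul b), ?_⟩
  exact (((hf x).2.const_mul a).sub ((hg x).2.const_mul b)).congr_deriv (by ring)

theorem wronskian_eq (hf : IsAirySolution f f') (hg : IsAirySolution g g') (x y : ℝ) :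
    f x * g' x - f' x * g x = f y * g' y - f' y * g y := by
  have h : ∀ z, HasDerivAt (fun z => f z * g' z - f' z * g z) 0 z := fun z =>
    (((hf z).1.mul (hg z).2).sub ((hf z).2.mul (hg z).1)).congr_deriv (by ring)
  exact is_const_of_deriv_eq_zero (fun z => (h z).differentiableAt) (fun z => (h z).deriv) x y

theorem energy_lt (hf : IsAirySolution f f') (h0 : ∀ x, f x = 0 → f' x ≠ 0) {x t : ℝ}
    (hxt : x < t) : f' t ^ 2 - t * f t ^ 2 < f' x ^ 2 - x * f x ^ 2 := by
  have hd : ∀ s, HasDerivAt (fun s => f' s ^ 2 - s * f s ^ 2) (-(f s ^ 2)) s := fun s =>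
    (((hf s).2.pow 2).sub ((hasDerivAt_id s).mul ((hf s).1.pow 2))).congr_deriv
      (by simp; ring)
  have hc : Continuous fun s => f s ^ 2 := hf.continuous.pow 2
  have hI := intervalIntegral.integral_eq_sub_of_hasDerivAt (a := x) (b := t)
    (fun s _ => hd s) (hc.neg.intervalIntegrable _ _)
  rw [intervalIntegral.integral_neg] at hI
  have hpos : 0 < ∫ s in x..t, f s ^ 2 := by
    refine intervalIntegral.integral_pos hxt hc.continuousOn (fun s _ => sq_nonneg _) ?_
    by_contra! hn
    have hz : ∀ s ∈ Icc x t, f s = 0 := fun s hs =>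
      pow_eq_zero_iff (two_ne_zero) |>.1 (le_antisymm (hn s hs) (sq_nonneg _))
    have hm : (x + t) / 2 ∈ Ioo x t := ⟨by linarith, by linarith⟩
    refine h0 _ (hz _ (Ioo_subset_Icc_self hm)) ((hf _).1.unique ?_)
    refine (hasDerivAt_const ((x + t) / 2) (0 : ℝ)).congr_of_eventuallyEq ?_
    filter_upwards [Icc_mem_nhds hm.1 hm.2] with s hs using hz s hs
  linarith

theorem one_add_cube_le (hf : IsAirySolution f f') (h0 : f 0 = 1) (h0' : f' 0 = 0) {x : ℝ}
    (hx : 0 ≤ x) : 1 + x ^ 3 / 6 ≤ f x := by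
  have hnn : ∀ y, 0 ≤ y → 0 ≤ f y * f' y := by
    have hm : MonotoneOn (fun y => f y * f' y) (Ici 0) := by
      refine monotoneOn_of_hasDerivWithinAt_nonneg (convex_Ici 0)
        (HasDerivAt.continuousOn fun y _ => (hf y).1.mul (hf y).2)
        (fun y _ => ((hf y).1.mul (hf y).2).hasDerivWithinAt) ?_
      intro y hy
      rw [interior_Ici] at hy
      have := mul_nonneg (le_of_lt hy) (sq_nonneg (f y))
      nlinarith [sq_nonneg (f' y)]
    intro y hy
    have := hm self_mem_Ici hy hy
    simpa [h0, h0'] using this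
  have hsq : ∀ y, 0 ≤ y → 1 ≤ f y ^ 2 := by
    have hm : MonotoneOn (fun y => f y ^ 2) (Ici 0) := by
      refine monotoneOn_of_hasDerivWithinAt_nonneg (convex_Ici 0)
        (hf.continuous.pow 2).continuousOn
        (fun y _ => ((hf y).1.pow 2).hasDerivWithinAt) ?_
      intro y hy
      rw [interior_Ici] at hy
      have := hnn y (le_of_lt hy)
      simp
      linarith
    intro y hy
    have := hm self_mem_Ici hy hy
    simpa [h0] using this
  have hone : ∀ y, 0 ≤ y → 1 ≤ f y := by
    intro y hy
    by_contra! hlt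
    have hneg : f y ≤ 0 := by nlinarith [hsq y hy]
    obtain ⟨z, hz, hfz⟩ := intermediate_value_Icc' hy hf.continuous.continuousOn
      (show (0 : ℝ) ∈ Icc (f y) (f 0) from ⟨hneg, by simp [h0]⟩)
    have := hsq z hz.1
    rw [hfz] at this
    norm_num at this
  have hder : ∀ y, 0 ≤ y → 0 ≤ f' y - y ^ 2 / 2 := by
    have hd : ∀ y, HasDerivAt (fun y => f' y - y ^ 2 / 2) (y * f y - y) y := fun y =>
      ((hf y).2.sub ((hasDerivAt_pow 2 y).div_const 2)).congr_deriv (by simp)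
    have hm : MonotoneOn (fun y => f' y - y ^ 2 / 2) (Ici 0) := by
      refine monotoneOn_of_hasDerivWithinAt_nonneg (convex_Ici 0)
        (HasDerivAt.continuousOn fun y _ => hd y) (fun y _ => (hd y).hasDerivWithinAt) ?_
      intro y hy
      rw [interior_Ici] at hy
      nlinarith [hone y (le_of_lt hy), mem_Ioi.1 hy]
    intro y hy
    have := hm self_mem_Ici hy hy
    simpa [h0'] using this
  have hd : ∀ y, HasDerivAt (fun y => f y - y ^ 3 / 6) (f' y - y ^ 2 / 2) y := fun y =>
    ((hf y).1.sub ((hasDerivAt_pow 3 y).div_const 6)).congr_deriv (by simp; ring)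
  have hm : MonotoneOn (fun y => f y - y ^ 3 / 6) (Ici 0) := by
    refine monotoneOn_of_hasDerivWithinAt_nonneg (convex_Ici 0)
      (HasDerivAt.continuousOn fun y _ => hd y) (fun y _ => (hd y).hasDerivWithinAt) ?_
    intro y hy
    rw [interior_Ici] at hy
    exact hder y (le_of_lt hy)
  have := hm self_mem_Ici hx hx
  simp [h0] at this
  linarith

end IsAirySolution

theorem existsUnique_eq_of_deriv_lt {p q p' q' : ℝ → ℝ} {α β : ℝ} (h : α ≤ β)
    (hp : ∀ x ∈ Icc α β, HasDerivAt p (p' x) x) (hq : ∀ x ∈ Icc α β, HasDerivAt q (q' x) x)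
    (hα : q α ≤ p α) (hβ : p β < q β)
    (hpq : ∀ x ∈ Ico α β, p x = q x → p' x < q' x) :
    ∃! x, x ∈ Ico α β ∧ p x = q x := by
  have hcp : ContinuousOn p (Icc α β) := HasDerivAt.continuousOn hp
  have hcq : ContinuousOn q (Icc α β) := HasDerivAt.continuousOn hq
  have huniq : ∀ x ∈ Ico α β, ∀ y ∈ Ico α β, p x = q x → p y = q y → ¬ x < y := by
    intro x hx y hy hpx hpy hxy
    have hsub : Icc x y ⊆ Icc α β := Icc_subset_Icc hx.1 hy.2.le
    have hle : ∀ z ∈ Icc x y, p z ≤ q z := by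
      intro z hz
      refine image_le_of_deriv_right_lt_deriv_boundary' (hcp.mono hsub)
        (fun w hw => (hp w (hsub (Ico_subset_Icc_self hw))).hasDerivWithinAt) hpx.le
        (hcq.mono hsub)
        (fun w hw => (hq w (hsub (Ico_subset_Icc_self hw))).hasDerivWithinAt) ?_ hz
      intro w hw
      exact hpq w ⟨hx.1.trans hw.1, hw.2.trans hy.2⟩
    have hd := (hq y (Ico_subset_Icc_self hy)).sub (hp y (Ico_subset_Icc_self hy))
    have ht := (hasDerivAt_iff_tendsto_slope.1 hd).mono_left
      (nhdsWithin_mono y (show Iio y ⊆ {y}ᶜ from fun z hz => ne_of_lt hz))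
    have hle0 : q' y - p' y ≤ 0 := by
      refine le_of_tendsto ht ?_
      filter_upwards [Ioo_mem_nhdsLT hxy] with z hz
      rw [slope_def_field]
      refine div_nonpos_of_nonneg_of_nonpos ?_ (by linarith [hz.2])
      have := hle z ⟨hz.1.le, hz.2.le⟩
      simp only [Pi.sub_apply]
      linarith
    linarith [hpq y hy hpy]
  obtain ⟨x, hx, hx0⟩ := intermediate_value_Icc h (hcq.sub hcp)
    (show (0 : ℝ) ∈ Icc ((q - p) α) ((q - p) β) from ⟨by simpa using hα, by simpa using hβ.le⟩)
  have hx0' : p x = q x := by simp only [Pi.sub_apply] at hx0; linarith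
  have hxI : x ∈ Ico α β := by
    refine ⟨hx.1, lt_of_le_of_ne hx.2 ?_⟩
    rintro rfl
    exact hβ.ne hx0'
  refine ⟨x, ⟨hxI, hx0'⟩, fun y hy => ?_⟩
  exact le_antisymm (not_lt.1 (huniq x hxI y hy.1 hx0' hy.2))
    (not_lt.1 (huniq y hy.1 x hxI hy.2 hx0'))

/-- The moments `∫₀^∞ sᵏ exp(-s³/3 + z s) ds`. -/
noncomputable def cubicMoment (k : ℕ) (z : ℂ) : ℂ :=
  ∫ s in Ioi (0 : ℝ), (s : ℂ) ^ k * Complex.exp (-(s : ℂ) ^ 3 / 3 + z * s)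

theorem norm_cubic_kernel (k : ℕ) (z : ℂ) {s : ℝ} (hs : 0 ≤ s) :
    ‖(s : ℂ) ^ k * Complex.exp (-(s : ℂ) ^ 3 / 3 + z * s)‖ =
      s ^ k * exp (-s ^ 3 / 3 + z.re * s) := by
  have h : (-(s : ℂ) ^ 3 / 3 + z * s).re = -s ^ 3 / 3 + z.re * s := by
    have : -(s : ℂ) ^ 3 / 3 = ((-s ^ 3 / 3 : ℝ) : ℂ) := by push_cast; ring
    rw [this, Complex.add_re, Complex.ofReal_re, Complex.re_mul_ofReal]
  rw [norm_mul, norm_pow, Complex.norm_exp, h, Complex.norm_real, norm_of_nonneg hs]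

theorem norm_cubic_kernel_le (k : ℕ) {z : ℂ} {ρ s : ℝ} (hρ : 0 ≤ ρ) (hz : z.re ≤ ρ)
    (hs : 0 ≤ s) : ‖(s : ℂ) ^ k * Complex.exp (-(s : ℂ) ^ 3 / 3 + z * s)‖ ≤
      exp (ρ * (6 * ρ + 1)) * (s ^ (k : ℝ) * exp (-(1 / 6) * s ^ (3 : ℝ))) := by
  have h3 : s ^ (3 : ℝ) = s ^ 3 := by exact_mod_cast rpow_natCast s 3
  rw [norm_cubic_kernel k z hs, h3, rpow_natCast, mul_left_comm, ← exp_add]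
  refine mul_le_mul_of_nonneg_left (exp_le_exp.2 ?_) (by positivity)
  have h1 : z.re * s ≤ ρ * s := by gcongr
  have h2 : ρ * s ≤ s ^ 3 / 6 + ρ * (6 * ρ + 1) := by
    rcases le_total s (6 * ρ + 1) with h | h
    · have := mul_le_mul_of_nonneg_left h hρ
      have : 0 ≤ s ^ 3 := by positivity
      linarith
    · have : 6 * ρ ≤ s ^ 2 := by nlinarith
      have : 6 * ρ * s ≤ s ^ 2 * s := by gcongr
      have : 0 ≤ ρ * (6 * ρ + 1) := by positivity
      nlinarith
  linarith

theorem integrableOn_cubic_bound (k : ℕ) (C : ℝ) :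
    IntegrableOn (fun s : ℝ => C * (s ^ (k : ℝ) * exp (-(1 / 6) * s ^ (3 : ℝ)))) (Ioi 0) :=
  (integrableOn_rpow_mul_exp_neg_mul_rpow (by linarith [k.cast_nonneg (α := ℝ)]) (by norm_num)
    (by norm_num)).const_mul C

theorem continuous_cubic_kernel (k : ℕ) (z : ℂ) :
    Continuous fun s : ℝ => (s : ℂ) ^ k * Complex.exp (-(s : ℂ) ^ 3 / 3 + z * s) := by
  fun_prop

theorem integrableOn_cubic_kernel (k : ℕ) (z : ℂ) :
    IntegrableOn (fun s : ℝ => (s : ℂ) ^ k * Complex.exp (-(s : ℂ) ^ 3 / 3 + z * s)) (Ioi 0) := by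
  refine Integrable.mono' (integrableOn_cubic_bound k (exp (|z.re| * (6 * |z.re| + 1))))
    (continuous_cubic_kernel k z).aestronglyMeasurable ?_
  filter_upwards [ae_restrict_mem measurableSet_Ioi] with s hs
  exact norm_cubic_kernel_le k (abs_nonneg z.re) (le_abs_self _) (le_of_lt hs)

theorem hasDerivAt_cubicMoment (k : ℕ) (z : ℂ) :
    HasDerivAt (cubicMoment k) (cubicMoment (k + 1) z) z := by
  refine (hasDerivAt_integral_of_dominated_loc_of_deriv_le
    (F' := fun w (s : ℝ) => (s : ℂ) ^ (k + 1) * Complex.exp (-(s : ℂ) ^ 3 / 3 + w * s))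
    (Metric.ball_mem_nhds z one_pos)
    (Eventually.of_forall fun w => (continuous_cubic_kernel k w).aestronglyMeasurable)
    (integrableOn_cubic_kernel k z) (continuous_cubic_kernel (k + 1) z).aestronglyMeasurable
    ?_ (integrableOn_cubic_bound (k + 1) (exp ((|z.re| + 1) * (6 * (|z.re| + 1) + 1)))) ?_).2
  · filter_upwards [ae_restrict_mem measurableSet_Ioi] with s hs w hw
    refine norm_cubic_kernel_le (k + 1) (by positivity) ?_ (le_of_lt hs)
    have h1 : ‖w - z‖ < 1 := by simpa [dist_eq_norm] using hw
    have h2 := (Complex.re_le_norm (w - z)).trans h1.le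
    rw [Complex.sub_re] at h2
    linarith [le_abs_self z.re]
  · refine Eventually.of_forall fun s w _ => ?_
    have h := (((hasDerivAt_id w).mul_const (s : ℂ)).const_add (-(s : ℂ) ^ 3 / 3)).cexp.const_mul
      ((s : ℂ) ^ k)
    exact h.congr_deriv (by simp; ring)

theorem cubicMoment_two (z : ℂ) : cubicMoment 2 z = z * cubicMoment 0 z + 1 := by
  have hd : ∀ s ∈ Ici (0 : ℝ), HasDerivAt
      (fun s : ℝ => Complex.exp (-(s : ℂ) ^ 3 / 3 + z * s))
      (z * ((s : ℂ) ^ 0 * Complex.exp (-(s : ℂ) ^ 3 / 3 + z * s)) -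
        (s : ℂ) ^ 2 * Complex.exp (-(s : ℂ) ^ 3 / 3 + z * s)) s := by
    intro s _
    have h : HasDerivAt (fun w : ℂ => Complex.exp (-w ^ 3 / 3 + z * w))
        (z * ((s : ℂ) ^ 0 * Complex.exp (-(s : ℂ) ^ 3 / 3 + z * s)) -
        (s : ℂ) ^ 2 * Complex.exp (-(s : ℂ) ^ 3 / 3 + z * s)) (s : ℂ) :=
      (((hasDerivAt_pow 3 (s : ℂ)).neg.div_const 3).add
        ((hasDerivAt_id (s : ℂ)).const_mul z)).cexp.congr_deriv (by simp; ring)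
    exact h.comp_ofReal
  have ht : Tendsto (fun s : ℝ => Complex.exp (-(s : ℂ) ^ 3 / 3 + z * s)) atTop (𝓝 0) := by
    rw [tendsto_zero_iff_norm_tendsto_zero]
    have hb : Tendsto (fun s : ℝ => exp (|z.re| * (6 * |z.re| + 1)) * exp (-(1 / 6 * s ^ (3 : ℝ))))
        atTop (𝓝 0) := by
      have := tendsto_exp_neg_atTop_nhds_zero.comp
        ((tendsto_rpow_atTop (show (0 : ℝ) < 3 by norm_num)).const_mul_atTop
          (show (0 : ℝ) < 1 / 6 by norm_num))
      simpa using this.const_mul (exp (|z.re| * (6 * |z.re| + 1)))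
    refine squeeze_zero' (Eventually.of_forall fun s => norm_nonneg _) ?_ hb
    filter_upwards [eventually_ge_atTop 0] with s hs
    simpa using norm_cubic_kernel_le 0 (abs_nonneg z.re) (le_abs_self _) hs
  have h0 := integrableOn_cubic_kernel 0 z
  have h2 := integrableOn_cubic_kernel 2 z
  have h := integral_Ioi_of_hasDerivAt_of_tendsto' hd ((h0.const_mul z).sub h2) ht
  rw [integral_sub (h0.const_mul z) h2, integral_const_mul] at h
  simp only [Complex.ofReal_zero, mul_zero, add_zero] at h
  norm_num at h
  unfold cubicMoment
  simp only [pow_zero, one_mul]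
  linear_combination -h

theorem cubicMoment_apply_zero (k : ℕ) : cubicMoment k 0 =
    (((1 / 3 : ℝ) ^ (-((k : ℝ) + 1) / 3) * (1 / 3) * Gamma (((k : ℝ) + 1) / 3) : ℝ) : ℂ) := by
  rw [← integral_rpow_mul_exp_neg_mul_rpow (show (0 : ℝ) < 3 by norm_num)
    (show (-1 : ℝ) < k by linarith [k.cast_nonneg (α := ℝ)]) (show (0 : ℝ) < 1 / 3 by norm_num),
    ← integral_complex_ofReal]
  refine integral_congr_ae (Eventually.of_forall fun s => ?_)
  have h3 : s ^ (3 : ℝ) = s ^ 3 := by exact_mod_cast rpow_natCast s 3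
  simp only [h3, rpow_natCast]
  push_cast
  congr 2
  ring

theorem norm_cubicMoment_zero_le {z : ℂ} (hz : z.re ≤ 0) :
    ‖cubicMoment 0 z‖ ≤ ∫ s in Ioi (0 : ℝ),
      1 * (s ^ ((0 : ℕ) : ℝ) * exp (-(1 / 6) * s ^ (3 : ℝ))) := by
  refine norm_integral_le_of_norm_le (integrableOn_cubic_bound 0 1) ?_
  filter_upwards [ae_restrict_mem measurableSet_Ioi] with s hs
  simpa using norm_cubic_kernel_le 0 le_rfl hz (le_of_lt hs)

/-- The primitive cube root of unity `exp(2πi/3)`. -/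
noncomputable def cubeRootUnity : ℂ := ⟨-1 / 2, √3 / 2⟩

/-- The twelfth root of unity `exp(πi/6)`. -/
noncomputable def twelfthRootUnity : ℂ := ⟨√3 / 2, 1 / 2⟩

theorem cubeRootUnity_pow_three : cubeRootUnity ^ 3 = 1 := by
  have h := Real.sq_sqrt (show (0 : ℝ) ≤ 3 by norm_num)
  apply Complex.ext <;> simp [cubeRootUnity, pow_succ]
  · nlinarith
  · linear_combination -(√3 / 8) * h

theorem twelfthRootUnity_mul_cubeRootUnity_sq :
    twelfthRootUnity * cubeRootUnity ^ 2 = -Complex.I := by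
  have h := Real.sq_sqrt (show (0 : ℝ) ≤ 3 by norm_num)
  apply Complex.ext <;> simp [cubeRootUnity, twelfthRootUnity, pow_succ]
  · linear_combination -(√3 / 8) * h
  · nlinarith

/-- The Airy function, up to a constant factor `π`, as an absolutely convergent integral along
the ray of argument `π / 6`. -/
noncomputable def airyIntegral (x : ℝ) : ℝ :=
  (twelfthRootUnity * cubicMoment 0 (cubeRootUnity * x)).re

/-- The derivative of `airyIntegral`. -/
noncomputable def airyIntegralDeriv (x : ℝ) : ℝ :=
  (twelfthRootUnity * cubeRootUnity * cubicMoment 1 (cubeRootUnity * x)).re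

theorem isAirySolution_airyIntegral : IsAirySolution airyIntegral airyIntegralDeriv := by
  have key : ∀ (k : ℕ) (a : ℂ) (x : ℝ), HasDerivAt
      (fun x : ℝ => (a * cubicMoment k (cubeRootUnity * x)).re)
      (a * cubeRootUnity * cubicMoment (k + 1) (cubeRootUnity * x)).re x := by
    intro k a x
    have h : HasDerivAt (fun z : ℂ => a * cubicMoment k (cubeRootUnity * z))
        (a * cubeRootUnity * cubicMoment (k + 1) (cubeRootUnity * x)) (x : ℂ) := by
      refine (((hasDerivAt_cubicMoment k (cubeRootUnity * x)).comp (x : ℂ)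
        ((hasDerivAt_id (x : ℂ)).const_mul cubeRootUnity)).const_mul a).congr_deriv ?_
      simp
      ring
    exact h.real_of_complex
  intro x
  refine ⟨key 0 _ x, (key 1 _ x).congr_deriv ?_⟩
  have h : twelfthRootUnity * cubeRootUnity * cubeRootUnity *
      cubicMoment (1 + 1) (cubeRootUnity * x) =
      x * (twelfthRootUnity * cubicMoment 0 (cubeRootUnity * x)) - Complex.I := by
    rw [show 1 + 1 = 2 from rfl, cubicMoment_two]
    linear_combination (x * twelfthRootUnity * cubicMoment 0 (cubeRootUnity * x)) *
      cubeRootUnity_pow_three + twelfthRootUnity_mul_cubeRootUnity_sq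
  rw [h, Complex.sub_re, Complex.re_ofReal_mul, Complex.I_re, sub_zero, airyIntegral]

theorem airyIntegral_zero :
    airyIntegral 0 = √3 / 6 * ((3 : ℝ) ^ ((1 : ℝ) / 3) * Gamma (1 / 3)) := by
  have h : (1 / 3 : ℝ) ^ (-(1 : ℝ) / 3) = 3 ^ ((1 : ℝ) / 3) := by
    rw [one_div, inv_rpow (by norm_num), ← rpow_neg (by norm_num)]
    norm_num
  rw [airyIntegral, Complex.ofReal_zero, mul_zero, cubicMoment_apply_zero, Complex.re_mul_ofReal]
  simp only [Nat.cast_zero, zero_add]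
  rw [h, twelfthRootUnity]
  ring

theorem airyIntegralDeriv_zero :
    airyIntegralDeriv 0 = -(√3 / 6 * ((3 : ℝ) ^ ((2 : ℝ) / 3) * Gamma (2 / 3))) := by
  have h : (1 / 3 : ℝ) ^ (-(2 : ℝ) / 3) = 3 ^ ((2 : ℝ) / 3) := by
    rw [one_div, inv_rpow (by norm_num), ← rpow_neg (by norm_num)]
    norm_num
  have hre : (twelfthRootUnity * cubeRootUnity).re = -(√3 / 2) := by
    simp [twelfthRootUnity, cubeRootUnity]
    ring
  rw [airyIntegralDeriv, Complex.ofReal_zero, mul_zero, cubicMoment_apply_zero,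
    Complex.re_mul_ofReal, hre]
  rw [Nat.cast_one, one_add_one_eq_two, h]
  ring

theorem exists_airyIntegral_bound : ∃ C, ∀ x, 0 ≤ x → |airyIntegral x| ≤ C := by
  refine ⟨‖twelfthRootUnity‖ * ∫ s in Ioi (0 : ℝ),
    1 * (s ^ ((0 : ℕ) : ℝ) * exp (-(1 / 6) * s ^ (3 : ℝ))), fun x hx => (Complex.abs_re_le_norm _).trans ?_⟩
  rw [norm_mul]
  refine mul_le_mul_of_nonneg_left (norm_cubicMoment_zero_le ?_) (norm_nonneg _)
  rw [Complex.re_mul_ofReal, cubeRootUnity]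
  nlinarith

theorem IsAirySolution.mul_lt_mul_of_nonneg {u v u' v' : ℝ → ℝ} (hu : IsAirySolution u u')
    (hv : IsAirySolution v v') (hu0 : u 0 = 1) (hu'0 : u' 0 = 0) (hv0 : v 0 = 0)
    (hv'0 : v' 0 = 1) {t : ℝ} (ht : 0 ≤ t) :
    (3 : ℝ) ^ ((2 : ℝ) / 3) * Gamma (2 / 3) * v t <
      (3 : ℝ) ^ ((1 : ℝ) / 3) * Gamma (1 / 3) * u t := by
  set κ₁ := (3 : ℝ) ^ ((2 : ℝ) / 3) * Gamma (2 / 3)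
  set κ₂ := (3 : ℝ) ^ ((1 : ℝ) / 3) * Gamma (1 / 3)
  have hκ₁ : 0 < κ₁ := mul_pos (by positivity) (Gamma_pos_of_pos (by norm_num))
  have hs : 0 < √3 / 6 := by positivity
  have hf : ∀ x, airyIntegral x = √3 / 6 * (κ₂ * u x - κ₁ * v x) := by
    intro x
    have h1 := isAirySolution_airyIntegral.wronskian_eq hu x 0
    have h2 := isAirySolution_airyIntegral.wronskian_eq hv x 0
    have h3 := hu.wronskian_eq hv x 0
    rw [hu0, hu'0, airyIntegralDeriv_zero] at h1
    rw [hv0, hv'0, airyIntegral_zero] at h2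
    rw [hu0, hu'0, hv0, hv'0] at h3
    linear_combination u x * h2 - v x * h1 - airyIntegral x * h3
  obtain ⟨C, hC⟩ := exists_airyIntegral_bound
  have hge : ∀ x, 0 ≤ x → 1 + x ^ 3 / 6 ≤ u x := fun x hx => hu.one_add_cube_le hu0 hu'0 hx
  have hpos : ∀ x, 0 ≤ x → 0 < u x := fun x hx => by
    have := hge x hx
    have : 0 ≤ x ^ 3 := by positivity
    linarith
  have hanti : StrictAntiOn (fun x => (κ₂ * u x - κ₁ * v x) / u x) (Ici 0) := by
    have hd : ∀ x ∈ Ici (0 : ℝ), HasDerivAt (fun x => (κ₂ * u x - κ₁ * v x) / u x)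
        (-κ₁ / u x ^ 2) x := by
      intro x hx
      refine ((hu.linear_comb hv κ₂ κ₁ x).1.div (hu x).1 (hpos x hx).ne').congr_deriv ?_
      have h3 := hu.wronskian_eq hv x 0
      rw [hu0, hu'0, hv0, hv'0] at h3
      congr 1
      linear_combination -κ₁ * h3
    refine strictAntiOn_of_hasDerivWithinAt_neg (f' := fun x => -κ₁ / u x ^ 2) (convex_Ici 0)
      (HasDerivAt.continuousOn hd)
      (fun x hx => (hd x (interior_subset hx)).hasDerivWithinAt) ?_
    intro x hx
    have := hpos x (interior_subset hx)
    exact div_neg_of_neg_of_pos (by linarith) (by positivity)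
  by_contra! hle
  have ht1 : (0 : ℝ) ≤ t + 1 := by linarith
  set δ := -((κ₂ * u (t + 1) - κ₁ * v (t + 1)) / u (t + 1))
  have hδ : 0 < δ := by
    have h1 := hanti ht ht1 (by linarith)
    have h2 : (κ₂ * u t - κ₁ * v t) / u t ≤ 0 :=
      div_nonpos_of_nonpos_of_nonneg (by linarith) (hpos t ht).le
    simp only at h1
    linarith
  have hbd : ∀ x, t + 1 ≤ x → √3 / 6 * δ * u x ≤ C := by
    intro x hx
    have hx0 : 0 ≤ x := ht1.trans hx
    have h1 : (κ₂ * u x - κ₁ * v x) / u x ≤ -δ := by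
      rw [neg_neg]
      exact hanti.antitoneOn ht1 hx0 hx
    rw [div_le_iff₀ (hpos x hx0)] at h1
    have h2 := (abs_le.1 (hC x hx0)).1
    rw [hf x] at h2
    have h3 := mul_le_mul_of_nonneg_left h1 hs.le
    linarith
  set M := √3 / 6 * δ
  have hM : 0 < M := mul_pos hs hδ
  set x := t + 1 + 6 * |C| / M
  have hx1 : t + 1 ≤ x := le_add_of_nonneg_right (by positivity)
  have h1 : 1 ≤ x := by linarith
  have h2 : x ≤ x ^ 3 := le_self_pow₀ h1 (by norm_num)
  have h3 := hbd x hx1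
  have h4 := mul_le_mul_of_nonneg_left (hge x (by linarith)) hM.le
  have h5 : 6 * |C| ≤ M * x := by
    have : 6 * |C| / M ≤ x := by linarith
    rw [div_le_iff₀ hM] at this
    linarith
  nlinarith [le_abs_self C, mul_le_mul_of_nonneg_left h2 hM.le]

section DirichletSolution

variable {u v u' v' : ℝ → ℝ} {x t : ℝ}

theorem energy_dirichlet_lt (hu : IsAirySolution u u') (hv : IsAirySolution v v')
    (hW : ∀ x, u x * v' x - u' x * v x = 1) (ht : u t ≠ 0) (hxt : x < t) :
    1 < (v t * u' x - u t * v' x) ^ 2 - x * (v t * u x - u t * v x) ^ 2 := by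
  have h := (hu.linear_comb hv (v t) (u t)).energy_lt (x := x) (t := t) (fun y h0 h1 => ht ?_) hxt
  · have h1 : v t * u' t - u t * v' t = -1 := by linear_combination -hW t
    have h2 : v t * u t - u t * v t = 0 := by ring
    simpa [h1, h2] using h
  · linear_combination u' y * h0 - u y * h1 - u t * hW y

theorem neumann_dirichlet_lt (hu : IsAirySolution u u') (hv : IsAirySolution v v')
    (hW : ∀ x, u x * v' x - u' x * v x = 1) (ht : u t ≠ 0) (hxt : x < t)
    (h : v t * u' x = u t * v' x) : u' x ^ 2 < -x * u t ^ 2 := by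
  have he := energy_dirichlet_lt hu hv hW ht hxt
  have hφ : (v t * u x - u t * v x) * u' x = u t := by
    linear_combination u x * h + u t * hW x
  have hx : u' x ≠ 0 := fun h0 => ht (by rw [← hφ, h0, mul_zero])
  have h0 : v t * u' x - u t * v' x = 0 := sub_eq_zero.2 h
  have := mul_lt_mul_of_pos_right he (show 0 < u' x ^ 2 by positivity)
  rw [h0] at this
  rw [← hφ]
  linarith

theorem dirichlet_dirichlet_lt (hu : IsAirySolution u u') (hv : IsAirySolution v v')
    (hW : ∀ x, u x * v' x - u' x * v x = 1) (ht : u t ≠ 0) (hxt : x < t)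
    (h : v t * u x = u t * v x) : u x ^ 2 < 1 * u t ^ 2 := by
  have he := energy_dirichlet_lt hu hv hW ht hxt
  have hφ : (v t * u' x - u t * v' x) * u x = -u t := by
    linear_combination u' x * h - u t * hW x
  have hx : u x ≠ 0 := fun h0 => ht (by rw [h0, mul_zero] at hφ; linarith)
  have h0 : v t * u x - u t * v x = 0 := sub_eq_zero.2 h
  have := mul_lt_mul_of_pos_right he (show 0 < u x ^ 2 by positivity)
  rw [h0] at this
  calc u x ^ 2 < ((v t * u' x - u t * v' x) * u x) ^ 2 := by linarith
    _ = 1 * u t ^ 2 := by rw [hφ]; ring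

end DirichletSolution

theorem ne_zero_of_ratio_deriv_pos {a b a' b' w : ℝ → ℝ} {α β L : ℝ} (hαβ : α < β) (hL : 0 < L)
    (ha : ∀ x, HasDerivAt a (a' x) x) (hb : ∀ x, HasDerivAt b (b' x) x)
    (hw : ∀ x, a x * b' x - a' x * b x = w x) (hwpos : ∀ x ∈ Icc α β, 0 < w x)
    (hα : b α = 0) (hβ : b β = L * a β) (hne : ∀ x ∈ Ioo α β, b x ≠ 0) :
    ∀ x ∈ Icc α β, a x ≠ 0 := by
  have hboth : ∀ x ∈ Icc α β, a x = 0 → b x ≠ 0 := fun x hx h1 h2 => by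
    have := hw x
    rw [h1, h2] at this
    linarith [hwpos x hx]
  have haβ : a β ≠ 0 := fun h =>
    hboth β (right_mem_Icc.2 hαβ.le) h (by rw [hβ, h, mul_zero])
  have hbne : ∀ x ∈ Ioc α β, b x ≠ 0 := by
    intro x hx
    rcases hx.2.eq_or_lt with rfl | h
    · rw [hβ]
      exact mul_ne_zero hL.ne' haβ
    · exact hne x ⟨hx.1, h⟩
  have hd : ∀ x ∈ Ioc α β, HasDerivAt (fun x => a x / b x) (-w x / b x ^ 2) x := fun x hx =>
    ((ha x).div (hb x) (hbne x hx)).congr_deriv (by rw [← hw x]; ring)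
  have hanti : StrictAntiOn (fun x => a x / b x) (Ioc α β) := by
    refine strictAntiOn_of_hasDerivWithinAt_neg (f' := fun x => -w x / b x ^ 2) (convex_Ioc α β)
      (HasDerivAt.continuousOn hd)
      (fun x hx => (hd x (interior_subset hx)).hasDerivWithinAt) ?_
    intro x hx
    have hx' := interior_subset hx
    have := hwpos x (Ioc_subset_Icc_self hx')
    have := hbne x hx'
    exact div_neg_of_neg_of_pos (by linarith) (by positivity)
  intro x hx h0
  rcases hx.1.eq_or_lt with rfl | hαx
  · exact hboth α hx h0 hα
  · have h1 := hanti.antitoneOn ⟨hαx, hx.2⟩ ⟨hαβ, le_rfl⟩ hx.2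
    have h2 : a β / b β = 1 / L := by
      rw [hβ]
      field_simp
    simp only [h0, zero_div, h2] at h1
    have : 0 < 1 / L := by positivity
    linarith

theorem existsUnique_eigenvalue {u v u' v' a b a' b' w : ℝ → ℝ} (hu : IsAirySolution u u')
    (hv : IsAirySolution v v') (hW : ∀ x, u x * v' x - u' x * v x = 1) (hv0 : v 0 = 0)
    (hpos : ∀ t, 0 ≤ t → 0 < u t)
    (ha : ∀ x, HasDerivAt a (a' x) x) (hb : ∀ x, HasDerivAt b (b' x) x)
    (hw : ∀ x, a x * b' x - a' x * b x = w x) (hwpos : ∀ x < 0, 0 < w x) {R B L c : ℝ}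
    (hL : 0 < L) (hvL : ∀ t, 0 ≤ t → v t < L * u t) (hB : 0 < B) (hBR : B < R) (hc : R ≤ c)
    (hbR : b (-R) = 0) (hbB : b (-B) = L * a (-B)) (hne : ∀ x ∈ Ioo (-R) (-B), b x ≠ 0)
    (hcross : ∀ x t, x < t → 0 ≤ t → v t * a x = u t * b x → a x ^ 2 < w x * u t ^ 2) :
    ∃! E : ℝ, E ≤ 0 ∧ -R ≤ -c - E ∧ -c - E < -B ∧
      v (-E) * a (-c - E) = u (-E) * b (-c - E) := by
  have hRB : -R < -B := neg_lt_neg hBR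
  have hane := ne_zero_of_ratio_deriv_pos hRB hL ha hb hw
    (fun x hx => hwpos x (by linarith [hx.2])) hbR hbB hne
  have hdp : ∀ t, 0 ≤ t → HasDerivAt (fun t => v t / u t) (1 / u t ^ 2) t := fun t ht =>
    ((hv t).1.div (hu t).1 (hpos t ht).ne').congr_deriv (by rw [← hW t]; ring)
  have hpnn : 0 ≤ v (c - R) / u (c - R) := by
    have hm : MonotoneOn (fun t => v t / u t) (Ici 0) :=
      monotoneOn_of_hasDerivWithinAt_nonneg (f' := fun t => 1 / u t ^ 2) (convex_Ici 0)
        (HasDerivAt.continuousOn hdp)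
        (fun t ht => (hdp t (interior_subset ht)).hasDerivWithinAt) (fun t _ => by positivity)
    have hcR : 0 ≤ c - R := sub_nonneg.2 hc
    simpa [hv0] using hm self_mem_Ici hcR hcR
  have hiff : ∀ x ∈ Ico (-R) (-B),
      (v (x + c) / u (x + c) = b x / a x ↔ v (x + c) * a x = u (x + c) * b x) := by
    intro x hx
    rw [div_eq_div_iff (hpos _ (by linarith [hx.1])).ne' (hane x (Ico_subset_Icc_self hx)),
      mul_comm (b x)]
  obtain ⟨x, ⟨hx, hxe⟩, huniq⟩ := existsUnique_eq_of_deriv_lt (p := fun x => v (x + c) / u (x + c))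
    (q := fun x => b x / a x) (p' := fun x => 1 / u (x + c) ^ 2) (q' := fun x => w x / a x ^ 2)
    hRB.le
    (fun x hx => (hdp (x + c) (by linarith [hx.1])).comp_add_const x c)
    (fun x hx => ((hb x).div (ha x) (hane x hx)).congr_deriv (by rw [← hw x]; ring))
    (by simpa [hbR, neg_add_eq_sub] using hpnn)
    (by
      have h0 : 0 ≤ -B + c := by linarith
      have h1 := hane (-B) (right_mem_Icc.2 hRB.le)
      rw [hbB, mul_div_cancel_right₀ _ h1, div_lt_iff₀ (hpos _ h0)]
      exact hvL _ h0)
    (by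
      intro x hx h
      have h0 : 0 ≤ x + c := by linarith [hx.1]
      have h1 := hane x (Ico_subset_Icc_self hx)
      have h2 := hcross x (x + c) (by linarith) h0 ((hiff x hx).1 h)
      have := hpos _ h0
      rw [div_lt_div_iff₀ (by positivity) (by positivity)]
      linarith)
  refine ⟨-c - x, ?_, ?_⟩
  · have h1 : -c - (-c - x) = x := by ring
    have h2 : -(-c - x) = x + c := by ring
    simp only [h1, h2]
    exact ⟨by linarith [hx.1], hx.1, hx.2, (hiff x hx).1 hxe⟩
  · rintro E ⟨-, h1, h2, h3⟩
    have h4 : -c - E + c = -E := by ring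
    have h5 := huniq (-c - E) ⟨⟨h1, h2⟩, (hiff _ ⟨h1, h2⟩).2 (by rw [h4]; exact h3)⟩
    linarith

theorem stmt_14 (u v u' v' : ℝ → ℝ)
    (hu : ∀ x, HasDerivAt u (u' x) x)
    (huAiry : ∀ x, HasDerivAt u' (x * u x) x)
    (hv : ∀ x, HasDerivAt v (v' x) x)
    (hvAiry : ∀ x, HasDerivAt v' (x * v x) x)
    (hu0 : u 0 = 1) (hu'0 : u' 0 = 0) (hv0 : v 0 = 0) (hv'0 : v' 0 = 1) :
    -- Even case
    (∀ R B : ℝ, 0 < B → B < R →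
      v' (-R) = 0 → AiD u' v' (-B) = 0 →
      (∀ x ∈ Ioo (-R) (-B), v' x ≠ 0 ∧ AiD u' v' x ≠ 0) →
      ∀ c : ℝ, R ≤ c →
        (∃! E : ℝ, E ≤ 0 ∧ -R ≤ -c - E ∧ -c - E < -B ∧
          v (-E) * u' (-c - E) = u (-E) * v' (-c - E)) ∧
        (∀ E : ℝ, (E ≤ 0 ∧ -R ≤ -c - E ∧ -c - E < -B ∧
            v (-E) * u' (-c - E) = u (-E) * v' (-c - E)) →
          -c + B < E ∧ E ≤ -c + R)) ∧
    -- Odd case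
    (∀ R' B' : ℝ, 0 < B' → B' < R' →
      v (-R') = 0 → AiF u v (-B') = 0 →
      (∀ x ∈ Ioo (-R') (-B'), v x ≠ 0 ∧ AiF u v x ≠ 0) →
      ∀ c : ℝ, R' ≤ c →
        (∃! E : ℝ, E ≤ 0 ∧ -R' ≤ -c - E ∧ -c - E < -B' ∧
          u (-E) * v (-c - E) = v (-E) * u (-c - E)) ∧
        (∀ E : ℝ, (E ≤ 0 ∧ -R' ≤ -c - E ∧ -c - E < -B' ∧
            u (-E) * v (-c - E) = v (-E) * u (-c - E)) →
          -c + B' < E ∧ E ≤ -c + R')) := by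
  have hau : IsAirySolution u u' := fun x => ⟨hu x, huAiry x⟩
  have hav : IsAirySolution v v' := fun x => ⟨hv x, hvAiry x⟩
  have hW : ∀ x, u x * v' x - u' x * v x = 1 := fun x => by
    rw [hau.wronskian_eq hav x 0, hu0, hu'0, hv0, hv'0]
    norm_num
  have hpos : ∀ t, 0 ≤ t → 0 < u t := fun t ht => by
    have := hau.one_add_cube_le hu0 hu'0 ht
    have : 0 ≤ t ^ 3 := by positivity
    linarith
  have hlt := fun t (ht : 0 ≤ t) => hau.mul_lt_mul_of_nonneg hav hu0 hu'0 hv0 hv'0 ht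
  unfold AiD AiF
  have hκ₁ : 0 < (3 : ℝ) ^ ((2 : ℝ) / 3) * Gamma (2 / 3) :=
    mul_pos (by positivity) (Gamma_pos_of_pos (by norm_num))
  have hκ₂ : 0 < (3 : ℝ) ^ ((1 : ℝ) / 3) * Gamma (1 / 3) :=
    mul_pos (by positivity) (Gamma_pos_of_pos (by norm_num))
  generalize (3 : ℝ) ^ ((2 : ℝ) / 3) * Gamma (2 / 3) = κ₁ at *
  generalize (3 : ℝ) ^ ((1 : ℝ) / 3) * Gamma (1 / 3) = κ₂ at *
  have hL : 0 < κ₂ / κ₁ := div_pos hκ₂ hκ₁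
  have hvL : ∀ t, 0 ≤ t → v t < κ₂ / κ₁ * u t := fun t ht => by
    rw [div_mul_eq_mul_div, lt_div_iff₀ hκ₁, mul_comm]
    exact hlt t ht
  have hzero : ∀ a b : ℝ, a / κ₁ - b / κ₂ = 0 → b = κ₂ / κ₁ * a := fun a b h => by
    field_simp at h ⊢
    linarith
  refine ⟨fun R B hB hBR hR hAi hne c hc => ⟨?_, fun E hE => ?_⟩,
    fun R B hB hBR hR hAi hne c hc => ⟨?_, fun E hE => ?_⟩⟩
  · exact existsUnique_eigenvalue hau hav hW hv0 hpos huAiry hvAiry (w := fun x => -x)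
      (fun x => by linear_combination -x * hW x) (fun x hx => neg_pos.2 hx) hL hvL hB hBR hc hR
      (hzero _ _ hAi) (fun x hx => (hne x hx).1)
      (fun x t hxt ht h => neumann_dirichlet_lt hau hav hW (hpos t ht).ne' hxt h)
  · exact ⟨by linarith [hE.2.2.1], by linarith [hE.2.1]⟩
  · simp only [eq_comm (a := u _ * v _)]
    exact existsUnique_eigenvalue hau hav hW hv0 hpos hu hv (w := fun _ => 1)
      hW (fun _ _ => one_pos) hL hvL hB hBR hc hR
      (hzero _ _ hAi) (fun x hx => (hne x hx).1)
      (fun x t hxt ht h => dirichlet_dirichlet_lt hau hav hW (hpos t ht).ne' hxt h)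
  · exact ⟨by linarith [hE.2.2.1], by linarith [hE.2.1]⟩
end
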